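/- arXiv:1311.0750 — 3 statements merged into one kernel-verified Lean document; each statement's English description precedes it below -/
import Mathlib

section
/- If D = (P_0,P_1,...,P_k) is a non-separating ear decomposition of a finite simple 2-connected graph G, then for every index i the subgraph Ḡ_i of G induced by V̄_i is connected. -/
open SimpleGraph

universe u

variable {V : Type u}

/-- An ear decomposition `(P₀, P₁, …, P_k)` of a graph `G`: `P₀` is a cycle and each
subsequent ear `Pᵢ` (`1 ≤ i ≤ k`, here indexed by `Fin k`) is a path that intersects the
union of the previous ears exactly in its two endpoints; the edge sets of the ears
partition the edge set of `G`. -/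
structure EarDecomposition {V : Type u} (G : SimpleGraph V) where
  /-- the number of path-ears; the ears are `P₀, P₁, …, P_k`. -/
  k : ℕ
  /-- base point of the initial cycle `P₀` -/
  v0 : V
  /-- the initial ear `P₀` -/
  cycle : G.Walk v0 v0
  cycle_isCycle : cycle.IsCycle
  /-- the first endpoint of the ear `Pᵢ` -/
  s : Fin k → V
  /-- the second endpoint of the ear `Pᵢ` -/
  t : Fin k → V
  /-- the ear `Pᵢ`, `1 ≤ i ≤ k` (indexed here by `i-1 : Fin k`) -/
  path : (i : Fin k) → G.Walk (s i) (t i)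
  path_isPath : ∀ i, (path i).IsPath
  path_length_pos : ∀ i, 0 < (path i).length
  /-- the ears cover all edges of `G` -/
  edges_cover : ∀ e ∈ G.edgeSet, e ∈ cycle.edges ∨ ∃ i, e ∈ (path i).edges
  /-- distinct ears have disjoint edge sets -/
  cycle_path_disjoint : ∀ (i : Fin k), ∀ e ∈ (path i).edges, e ∉ cycle.edges
  path_path_disjoint : ∀ i j : Fin k, i ≠ j → ∀ e ∈ (path i).edges, e ∉ (path j).edges
  /-- each ear intersects the union of the previous ears exactly in its endpoints -/
  meets_prev : ∀ (i : Fin k), ∀ x ∈ (path i).support,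
    ((x ∈ cycle.support ∨ ∃ j, j < i ∧ x ∈ (path j).support) ↔ (x = s i ∨ x = t i))

namespace EarDecomposition

variable {G : SimpleGraph V} (D : EarDecomposition G)

/-- The `i`-th ear `Pᵢ` as a subgraph of `G` (`P₀` is the initial cycle). -/
def ear (i : ℕ) : G.Subgraph :=
  if i = 0 then D.cycle.toSubgraph
  else if h : i - 1 < D.k then (D.path ⟨i - 1, h⟩).toSubgraph else ⊥

/-- The vertex set of the `i`-th ear. -/
def earSupport (i : ℕ) : Set V := (D.ear i).verts

/-- The edge set of the `i`-th ear. -/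
def earEdges (i : ℕ) : Set (Sym2 V) := (D.ear i).edgeSet

/-- The set of inner vertices of the `i`-th ear: for a path-ear, the vertices that are
not endpoints; every vertex of the initial cycle `P₀` counts as inner. -/
def inner (i : ℕ) : Set V :=
  if i = 0 then D.earSupport 0
  else if h : i - 1 < D.k then
    {x | x ∈ (D.path ⟨i - 1, h⟩).support ∧ x ≠ D.s ⟨i - 1, h⟩ ∧ x ≠ D.t ⟨i - 1, h⟩}
  else ∅

/-- Ear `Pᵢ` is long if it is not a single edge. -/
def IsLong (i : ℕ) : Prop :=
  i = 0 ∨ ∃ h : i - 1 < D.k, 2 ≤ (D.path ⟨i - 1, h⟩).length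

/-- The subgraph `G_i = P₀ ∪ P₁ ∪ ⋯ ∪ P_i`. -/
def partialGraph (i : ℕ) : G.Subgraph := ⨆ j ∈ Finset.range (i + 1), D.ear j

/-- `V̄ᵢ = V(G) − V(G_i)`. -/
def Vbar (i : ℕ) : Set V := (D.partialGraph i).vertsᶜ

/-- `Ḡᵢ`, the subgraph of `G` induced by `V̄ᵢ`. -/
def Gbar (i : ℕ) : G.Subgraph := (⊤ : G.Subgraph).induce (D.Vbar i)

/-- An ear decomposition is non-separating if, for every `i`, every inner vertex of `Pᵢ`
has a neighbor in `Ḡᵢ` unless `Ḡᵢ` is empty. -/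
def NonSeparating : Prop :=
  ∀ i ≤ D.k, (D.Vbar i).Nonempty → ∀ x ∈ D.inner i, ∃ y ∈ D.Vbar i, G.Adj x y

/-- `birth v` is the minimal `i` such that `Pᵢ` contains `v`. -/
noncomputable def birth (v : V) : ℕ := sInf {i | v ∈ D.earSupport i}

/-- `birthEdge e` is the index `i` such that `Pᵢ` contains the edge `e`. -/
noncomputable def birthEdge (e : Sym2 V) : ℕ := sInf {i | e ∈ D.earEdges i}

end EarDecomposition

/-- A graph is `k`-connected if it has more than `k` vertices and deleting any set of
fewer than `k` vertices leaves it connected. -/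
def KConnected (k : ℕ) (G : SimpleGraph V) : Prop :=
  k + 1 ≤ Nat.card V ∧ ∀ S : Set V, S.ncard < k → (G.induce Sᶜ).Connected

/-- A Mondshein sequence avoiding the edge `ru`: an ear decomposition of `G` such that
(1) `r ∈ P₀`; (2) `P_{birth u}` is the last long ear, contains `u` as its only inner
vertex and does not contain the edge `ru`; (3) the decomposition is non-separating. -/
def IsMondshein {G : SimpleGraph V} (D : EarDecomposition G) (r u : V) : Prop :=
  r ∈ D.earSupport 0 ∧
  D.IsLong (D.birth u) ∧
  (∀ j ≤ D.k, D.IsLong j → j ≤ D.birth u) ∧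
  D.inner (D.birth u) = {u} ∧
  s(r, u) ∉ D.earEdges (D.birth u) ∧
  D.NonSeparating

namespace EarDecomposition

theorem mem_Vbar {G : SimpleGraph V} (D : EarDecomposition G) (i : ℕ) (x : V) :
    x ∈ D.Vbar i ↔ ∀ j ≤ i, x ∉ D.earSupport j := by
  simp [Vbar, partialGraph, earSupport, Nat.lt_succ_iff]

theorem mem_earSupport_zero {G : SimpleGraph V} (D : EarDecomposition G) (x : V) :
    x ∈ D.earSupport 0 ↔ x ∈ D.cycle.support := by
  simp [earSupport, ear]

theorem mem_earSupport_succ {G : SimpleGraph V} (D : EarDecomposition G) (i : ℕ)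
    (h : i < D.k) (x : V) :
    x ∈ D.earSupport (i + 1) ↔ x ∈ (D.path ⟨i, h⟩).support := by
  simp [earSupport, ear, h]

theorem mem_inner_succ {G : SimpleGraph V} (D : EarDecomposition G) (i : ℕ)
    (h : i < D.k) (x : V) :
    x ∈ D.inner (i + 1) ↔
      x ∈ (D.path ⟨i, h⟩).support ∧ x ≠ D.s ⟨i, h⟩ ∧ x ≠ D.t ⟨i, h⟩ := by
  simp [inner, h]

theorem prev_iff {G : SimpleGraph V} (D : EarDecomposition G) (i : ℕ)
    (h : i < D.k) (x : V) :
    (x ∈ D.cycle.support ∨ ∃ j, j < (⟨i, h⟩ : Fin D.k) ∧ x ∈ (D.path j).support) ↔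
      x ∉ D.Vbar i := by
  rw [mem_Vbar]
  push Not
  constructor
  · rintro (hx | ⟨j, hj, hx⟩)
    · exact ⟨0, Nat.zero_le _, (D.mem_earSupport_zero x).2 hx⟩
    · exact ⟨j.1 + 1, hj, (D.mem_earSupport_succ j.1 j.2 x).2 hx⟩
  · rintro ⟨j, hj, hx⟩
    cases j with
    | zero => exact Or.inl ((D.mem_earSupport_zero x).1 hx)
    | succ j =>
      exact Or.inr ⟨⟨j, by omega⟩, hj, (D.mem_earSupport_succ j (by omega) x).1 hx⟩

theorem mem_Vbar_iff {G : SimpleGraph V} (D : EarDecomposition G) (i : ℕ)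
    (h : i < D.k) (x : V) :
    x ∈ D.Vbar i ↔ x ∈ D.Vbar (i + 1) ∨ x ∈ D.inner (i + 1) := by
  rw [mem_inner_succ D i h]
  have h1 : x ∈ D.Vbar (i + 1) ↔ x ∈ D.Vbar i ∧ x ∉ (D.path ⟨i, h⟩).support := by
    rw [mem_Vbar, mem_Vbar, ← mem_earSupport_succ D i h]
    constructor
    · intro hx
      exact ⟨fun j hj => hx j (by omega), hx _ le_rfl⟩
    · rintro ⟨ha, hb⟩ j hj
      rcases Nat.lt_or_ge i j with hij | hij
      · have : j = i + 1 := by omega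
        exact this ▸ hb
      · exact ha j hij
  have h2 := D.meets_prev ⟨i, h⟩ x
  rw [prev_iff D i h] at h2
  tauto

theorem Vbar_last [Fintype V] {G : SimpleGraph V} (hG : KConnected 2 G)
    (D : EarDecomposition G) : D.Vbar D.k = ∅ := by
  ext x
  simp only [Set.mem_empty_iff_false, iff_false]
  rw [mem_Vbar]
  intro hx
  have hc := hG.2 ∅ (by simp)
  have hcard := hG.1
  have : Nontrivial V := by
    rw [← Finite.one_lt_card_iff_nontrivial]
    omega
  obtain ⟨y, hy⟩ := exists_ne x
  obtain ⟨w⟩ := hc.preconnected ⟨x, by simp⟩ ⟨y, by simp⟩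
  have hadj : ∃ z, G.Adj x z := by
    cases w with
    | nil => exact absurd rfl hy
    | cons h _ => exact ⟨_, h⟩
  obtain ⟨z, hz⟩ := hadj
  rcases D.edges_cover s(x, z) hz with he | ⟨j, he⟩
  · exact hx 0 (Nat.zero_le _)
      ((D.mem_earSupport_zero x).2 (D.cycle.fst_mem_support_of_mem_edges he))
  · exact hx (j.1 + 1) j.2
      ((D.mem_earSupport_succ j.1 j.2 x).2 ((D.path j).fst_mem_support_of_mem_edges he))

end EarDecomposition

theorem path_inner_preconnected {G : SimpleGraph V} {s t : V} (p : G.Walk s t)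
    (hp : p.IsPath) (S : Set V)
    (hS : ∀ x, x ∈ S ↔ x ∈ p.support ∧ x ≠ s ∧ x ≠ t) :
    (G.induce S).Preconnected := by
  have hmem : ∀ n, 0 < n → n < p.length → p.getVert n ∈ S := by
    intro n h0 hn
    rw [hS]
    refine ⟨p.getVert_mem_support n, fun h => ?_, fun h => ?_⟩
    · rw [hp.getVert_eq_start_iff hn.le] at h
      omega
    · rw [hp.getVert_eq_end_iff hn.le] at h
      omega
  have key : ∀ n (hn : n + 1 < p.length) (h1 : 0 + 1 < p.length),
      (G.induce S).Reachable ⟨p.getVert (0 + 1), hmem _ (by omega) h1⟩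
        ⟨p.getVert (n + 1), hmem _ (by omega) hn⟩ := by
    intro n
    induction n with
    | zero => intro _ _; exact Reachable.refl _
    | succ n ih =>
      intro hn h1
      refine (ih (by omega) h1).trans (Adj.reachable ?_)
      exact p.adj_getVert_succ (by omega)
  have ex : ∀ x : S, ∃ n, ∃ hn : n + 1 < p.length,
      x = ⟨p.getVert (n + 1), hmem _ (by omega) hn⟩ := by
    rintro ⟨x, hx⟩
    obtain ⟨hx1, hx2, hx3⟩ := (hS x).1 hx
    obtain ⟨n, rfl, hn⟩ := Walk.mem_support_iff_exists_getVert.1 hx1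
    cases n with
    | zero => simp at hx2
    | succ n =>
      refine ⟨n, lt_of_le_of_ne hn ?_, rfl⟩
      intro h
      rw [h] at hx3
      simp at hx3
  intro x y
  obtain ⟨n, hn, rfl⟩ := ex x
  obtain ⟨m, hm, rfl⟩ := ex y
  exact (key n hn (by omega)).symm.trans (key m hm (by omega))

theorem extend_preconnected {G : SimpleGraph V} (S T : Set V) (hST : S ⊆ T)
    (hS : (G.induce S).Preconnected)
    (h : ∀ x ∈ T, x ∈ S ∨ ∃ y ∈ S, G.Adj x y) : (G.induce T).Preconnected := by
  have key : ∀ x : T, ∃ y, ∃ hy : y ∈ S, (G.induce T).Reachable x ⟨y, hST hy⟩ := by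
    rintro ⟨x, hx⟩
    rcases h x hx with hx' | ⟨y, hy, hxy⟩
    · exact ⟨x, hx', Reachable.refl _⟩
    · exact ⟨y, hy, Adj.reachable hxy⟩
  intro x y
  obtain ⟨a, ha, hxa⟩ := key x
  obtain ⟨b, hb, hyb⟩ := key y
  refine hxa.trans (Reachable.trans ?_ hyb.symm)
  exact (hS ⟨a, ha⟩ ⟨b, hb⟩).map (induceHomOfLE G hST).toHom

theorem Vbar_preconnected [Fintype V] {G : SimpleGraph V}
    (hG : KConnected 2 G) (D : EarDecomposition G) (hD : D.NonSeparating)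
    (i : ℕ) (hi : i ≤ D.k) : (G.induce (D.Vbar i)).Preconnected := by
  induction hi using Nat.decreasingInduction with
  | self =>
    rintro ⟨x, hx⟩
    rw [D.Vbar_last hG] at hx
    exact hx.elim
  | of_succ i hi ih =>
    have hm := D.mem_Vbar_iff i hi
    rcases (D.Vbar (i + 1)).eq_empty_or_nonempty with he | hne
    · refine path_inner_preconnected _ (D.path_isPath ⟨i, hi⟩) _ fun x => ?_
      rw [hm, he, D.mem_inner_succ i hi]
      simp
    · refine extend_preconnected _ _ (fun x hx => (hm x).2 (Or.inl hx)) ih fun x hx => ?_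
      exact ((hm x).1 hx).imp id (hD (i + 1) hi hne x)

/-- If `D` is a non-separating ear decomposition of a finite simple
2-connected graph `G`, then for every index `i` the subgraph `Ḡᵢ` of `G` induced by
`V̄ᵢ` is connected (the empty graph counting as connected). -/
theorem gbar_connected {V : Type u} [Fintype V] (G : SimpleGraph V)
    (hG : KConnected 2 G) (D : EarDecomposition G) (hD : D.NonSeparating)
    (i : ℕ) (hi : i ≤ D.k) :
    (D.Gbar i).coe.Preconnected := by
  have h := Vbar_preconnected hG D hD i hi
  rw [induce_eq_coe_induce_top] at h
  exact h
end

section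
/- A finite simple graph is 3-connected if and only if it can be constructed from the complete graph K_4 by a sequence of BG-operations. -/
open SimpleGraph

universe u

variable {V : Type u}

section BGOperations

variable {W : Type u}

/-- Vertex-vertex-addition: `G'` is obtained from `G` by adding an edge between two
distinct non-adjacent vertices. -/
def IsVVAdd (G : SimpleGraph V) (G' : SimpleGraph W) : Prop :=
  ∃ (e : V ≃ W) (x y : V), x ≠ y ∧ ¬G.Adj x y ∧
    ∀ z z' : V, G'.Adj (e z) (e z') ↔ (G.Adj z z' ∨ (z = x ∧ z' = y) ∨ (z = y ∧ z' = x))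

/-- Edge-vertex-addition: `G'` is obtained from `G` by subdividing an edge `ab`, `a ≠ b`,
by a new vertex `v` and adding the edge `vw` for a vertex `w ∉ {a, b}`. -/
def IsEVAdd (G : SimpleGraph V) (G' : SimpleGraph W) : Prop :=
  ∃ (f : V ↪ W) (v : W) (a b w : V),
    (∀ x, f x ≠ v) ∧ (∀ z : W, z = v ∨ ∃ x, f x = z) ∧
    G.Adj a b ∧ w ≠ a ∧ w ≠ b ∧
    (∀ x y : V, G'.Adj (f x) (f y) ↔ (G.Adj x y ∧ s(x, y) ≠ s(a, b))) ∧
    (∀ x : V, G'.Adj v (f x) ↔ (x = a ∨ x = b ∨ x = w))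

/-- Edge-edge-addition: `G'` is obtained from `G` by subdividing two distinct edges `ab`
and `cd` by new vertices `v` and `w`, respectively, and adding the edge `vw`. -/
def IsEEAdd (G : SimpleGraph V) (G' : SimpleGraph W) : Prop :=
  ∃ (f : V ↪ W) (v w : W) (a b c d : V),
    v ≠ w ∧ (∀ x, f x ≠ v ∧ f x ≠ w) ∧ (∀ z : W, z = v ∨ z = w ∨ ∃ x, f x = z) ∧
    G.Adj a b ∧ G.Adj c d ∧ s(a, b) ≠ s(c, d) ∧
    (∀ x y : V, G'.Adj (f x) (f y) ↔ (G.Adj x y ∧ s(x, y) ≠ s(a, b) ∧ s(x, y) ≠ s(c, d))) ∧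
    (∀ x : V, G'.Adj v (f x) ↔ (x = a ∨ x = b)) ∧
    (∀ x : V, G'.Adj w (f x) ↔ (x = c ∨ x = d)) ∧
    G'.Adj v w

/-- `G'` is obtained from `G` by a single BG-operation. -/
def IsBGOp (G : SimpleGraph V) (G' : SimpleGraph W) : Prop :=
  IsVVAdd G G' ∨ IsEVAdd G G' ∨ IsEEAdd G G'

/-- The graphs constructible from `K₄` by a sequence of BG-operations. -/
inductive BGConstructible : (Σ V : Type u, SimpleGraph V) → Prop
  | base {V : Type u} (G : SimpleGraph V) (h : Nonempty (G ≃g completeGraph (Fin 4))) :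
      BGConstructible ⟨V, G⟩
  | step {V W : Type u} (G : SimpleGraph V) (G' : SimpleGraph W)
      (hG : BGConstructible ⟨V, G⟩) (hop : IsBGOp G G') : BGConstructible ⟨W, G'⟩

end BGOperations

namespace BGProof

/-- No set of at most two vertices separates. -/
def NoCut {V : Type u} (G : SimpleGraph V) : Prop :=
  ∀ X S : Set V, S.ncard ≤ 2 → (∃ x, x ∈ X ∧ x ∉ S) → (∃ y, y ∉ X ∧ y ∉ S) →
    ∃ x y, x ∈ X ∧ x ∉ S ∧ y ∉ X ∧ y ∉ S ∧ G.Adj x y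

theorem kconn_iff {V : Type u} (G : SimpleGraph V) :
    KConnected 3 G ↔ (4 ≤ Nat.card V ∧ NoCut G) := by
  constructor
  · rintro ⟨h4, h⟩
    refine ⟨h4, ?_⟩
    rintro X S hS ⟨x, hx, hxS⟩ ⟨y, hy, hyS⟩
    obtain ⟨w⟩ := (h S (by omega)).preconnected ⟨x, hxS⟩ ⟨y, hyS⟩
    obtain ⟨d, -, hd1, hd2⟩ := w.exists_boundary_dart {z | z.1 ∈ X} hx hy
    exact ⟨d.fst.1, d.snd.1, hd1, d.fst.2, hd2, d.snd.2, d.adj⟩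
  · rintro ⟨h4, h⟩
    refine ⟨h4, fun S hS => ?_⟩
    have : Finite V := (Nat.card_pos_iff.1 (by omega)).2
    have hne : Nonempty ↥(Sᶜ) := by
      by_contra hcon
      have : S = Set.univ := by
        ext z
        simp only [Set.mem_univ, iff_true]
        by_contra hz
        exact hcon ⟨⟨z, hz⟩⟩
      rw [this, Set.ncard_univ] at hS
      omega
    refine { preconnected := ?_, nonempty := hne }
    rintro ⟨u, hu⟩ ⟨v, hv⟩
    by_contra hcon
    obtain ⟨x, y, ⟨hxs, hx⟩, -, hy, hyS, hadj⟩ :=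
      h {z | ∃ hz : z ∈ Sᶜ, (G.induce Sᶜ).Reachable ⟨u, hu⟩ ⟨z, hz⟩} S (by omega)
        ⟨u, ⟨hu, SimpleGraph.Reachable.refl _⟩, hu⟩ ⟨v, fun ⟨_, h'⟩ => hcon h', hv⟩
    apply hy
    refine ⟨hyS, hx.trans ?_⟩
    apply SimpleGraph.Adj.reachable
    exact hadj

theorem ncard_insert_le' {V : Type u} (S : Set V) (x : V) : (insert x S).ncard ≤ S.ncard + 1 :=
  Set.ncard_insert_le x S

theorem cut1 {V : Type u} {G : SimpleGraph V} (h4 : 4 ≤ Nat.card V) (h : NoCut G)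
    (X S : Set V) (hS : S.ncard ≤ 1) (hX : ∃ x, x ∈ X ∧ x ∉ S) (hY : ∃ y, y ∉ X ∧ y ∉ S)
    (e : Sym2 V) :
    ∃ x y, x ∈ X ∧ x ∉ S ∧ y ∉ X ∧ y ∉ S ∧ G.Adj x y ∧ s(x, y) ≠ e := by
  by_contra! hc
  have : Finite V := (Nat.card_pos_iff.1 (by omega)).2
  obtain ⟨x, y, hx, hxS, hy, hyS, hadj⟩ := h X S (by omega) hX hY
  have he := hc x y hx hxS hy hyS hadj
  have h1 : ∀ x', x' ∈ X → x' ∉ S → x' = x := by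
    intro x' hx' hxS'
    by_contra hne
    obtain ⟨x1, y1, a1, a2, a3, a4, a5⟩ := h X (insert x S)
      ((ncard_insert_le' S x).trans (by omega)) ⟨x', hx', by simp [hne, hxS']⟩
      ⟨y, hy, by simp only [Set.mem_insert_iff, not_or]; exact ⟨by rintro rfl; exact hy hx, hyS⟩⟩
    simp only [Set.mem_insert_iff, not_or] at a2 a4
    have := hc x1 y1 a1 a2.2 a3 a4.2 a5
    rw [← he, Sym2.eq_iff] at this
    rcases this with ⟨h1, -⟩ | ⟨h1, -⟩
    · exact a2.1 h1
    · exact hy (h1 ▸ a1)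
  have h2 : ∀ y', y' ∉ X → y' ∉ S → y' = y := by
    intro y' hy' hyS'
    by_contra hne
    obtain ⟨x1, y1, a1, a2, a3, a4, a5⟩ := h X (insert y S)
      ((ncard_insert_le' S y).trans (by omega))
      ⟨x, hx, by simp only [Set.mem_insert_iff, not_or]; exact ⟨by rintro rfl; exact hy hx, hxS⟩⟩
      ⟨y', hy', by simp [hne, hyS']⟩
    simp only [Set.mem_insert_iff, not_or] at a2 a4
    have := hc x1 y1 a1 a2.2 a3 a4.2 a5
    rw [← he, Sym2.eq_iff] at this
    rcases this with ⟨-, h1⟩ | ⟨-, h1⟩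
    · exact a4.1 h1
    · exact a3 (h1 ▸ hx)
  have h3 : (Set.univ : Set V) ⊆ insert x (insert y S) := by
    intro z _
    simp only [Set.mem_insert_iff]
    by_cases hz : z ∈ S
    · simp [hz]
    by_cases hz' : z ∈ X
    · exact Or.inl (h1 z hz' hz)
    · exact Or.inr (Or.inl (h2 z hz' hz))
  have h5 := Set.ncard_le_ncard h3
  rw [Set.ncard_univ] at h5
  have := ncard_insert_le' (insert y S) x
  have := ncard_insert_le' S y
  omega

theorem cut2 {V : Type u} {G : SimpleGraph V} (h4 : 4 ≤ Nat.card V) (h : NoCut G)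
    (X : Set V) (hX : ∃ x, x ∈ X) (hY : ∃ y, y ∉ X)
    (e e' : Sym2 V) :
    ∃ x y, x ∈ X ∧ y ∉ X ∧ G.Adj x y ∧ s(x, y) ≠ e ∧ s(x, y) ≠ e' := by
  by_contra! hc
  have : Finite V := (Nat.card_pos_iff.1 (by omega)).2
  obtain ⟨x0, hX0⟩ := hX
  obtain ⟨y0, hY0⟩ := hY
  obtain ⟨x, y, hx, -, hy, -, hadj, hne0⟩ := cut1 h4 h X ∅ (by simp) ⟨x0, hX0, by simp⟩
    ⟨y0, hY0, by simp⟩ e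
  have he := hc x y hx hy hadj hne0
  have h1 : ∀ x', x' ∈ X → x' = x := by
    intro x' hx'
    by_contra hne
    obtain ⟨x1, y1, a1, a2, a3, a4, a5, a6⟩ := cut1 h4 h X {x} (by simp) ⟨x', hx', hne⟩
      ⟨y, hy, by simp only [Set.mem_singleton_iff]; rintro rfl; exact hy hx⟩ e
    have := hc x1 y1 a1 a3 a5 a6
    rw [← he, Sym2.eq_iff] at this
    rcases this with ⟨h1, -⟩ | ⟨h1, -⟩
    · exact a2 h1
    · exact hy (h1 ▸ a1)
  have h2 : ∀ y', y' ∉ X → y' = y := by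
    intro y' hy'
    by_contra hne
    obtain ⟨x1, y1, a1, a2, a3, a4, a5, a6⟩ := cut1 h4 h X {y} (by simp)
      ⟨x, hx, by simp only [Set.mem_singleton_iff]; rintro rfl; exact hy hx⟩ ⟨y', hy', hne⟩ e
    have := hc x1 y1 a1 a3 a5 a6
    rw [← he, Sym2.eq_iff] at this
    rcases this with ⟨-, h1⟩ | ⟨-, h1⟩
    · exact a4 h1
    · exact a3 (h1 ▸ hx)
  have h3 : (Set.univ : Set V) ⊆ insert x (insert y ∅) := by
    intro z _
    simp only [Set.mem_insert_iff]
    by_cases hz' : z ∈ X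
    · exact Or.inl (h1 z hz')
    · exact Or.inr (Or.inl (h2 z hz'))
  have h5 := Set.ncard_le_ncard h3
  rw [Set.ncard_univ] at h5
  have h6 := ncard_insert_le' (insert y (∅ : Set V)) x
  have h7 := ncard_insert_le' (∅ : Set V) y
  rw [Set.ncard_empty] at h7
  omega

/-- Size of the preimage of a separator. -/
theorem pre_ncard {V W : Type u} [Finite W] (f : V ↪ W) (S : Set W) (T : Set W) (hT : T ⊆ S)
    (hf : ∀ x, f x ∉ T) : (f ⁻¹' S).ncard + T.ncard ≤ S.ncard := by
  rw [← Set.ncard_image_of_injective (f ⁻¹' S) f.injective, ← Set.ncard_union_eq]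
  · refine Set.ncard_le_ncard ?_ (Set.toFinite _)
    rintro z (⟨x, hx, rfl⟩ | hz)
    · exact hx
    · exact hT hz
  · rw [Set.disjoint_left]
    rintro z ⟨x, hx, rfl⟩ hz
    exact hf x hz

theorem three_not_le {W : Type u} [Finite W] (S : Set W) (hS : S.ncard ≤ 2) (a b c : W)
    (hab : a ≠ b) (hac : a ≠ c) (hbc : b ≠ c) (ha : a ∈ S) (hb : b ∈ S) (hc : c ∈ S) : False := by
  have : ({a, b, c} : Set W) ⊆ S := by
    rintro z (rfl | rfl | rfl) <;> assumption
  have h := Set.ncard_le_ncard this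
  rw [Set.ncard_eq_three.2 ⟨a, b, c, hab, hac, hbc, rfl⟩] at h
  omega

theorem fin_of_surj {V W : Type u} [Finite V] (f : V ↪ W) (v w : W)
    (h : ∀ z : W, z = v ∨ z = w ∨ ∃ x, f x = z) : Finite W := by
  have : (Set.univ : Set W) ⊆ insert v (insert w (Set.range f)) := by
    intro z _
    rcases h z with h | h | h
    · simp [h]
    · simp [h]
    · exact Or.inr (Or.inr h)
  exact Set.finite_univ_iff.1 (((Set.finite_range f).insert w |>.insert v).subset this)

theorem noCut_vv {V W : Type u} {G : SimpleGraph V} {G' : SimpleGraph W}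
    (h : NoCut G) (hop : IsVVAdd G G') : NoCut G' := by
  obtain ⟨e, x, y, hxy, hn, hadj⟩ := hop
  rintro X S hS ⟨x0, hx, hxS⟩ ⟨y0, hy, hyS⟩
  obtain ⟨x1, y1, a1, a2, a3, a4, a5⟩ := h (e ⁻¹' X) (e ⁻¹' S)
    (by
      rw [← Set.ncard_image_of_injective (e ⁻¹' S) e.injective]
      rwa [Set.image_preimage_eq _ e.surjective])
    ⟨e.symm x0, by simpa, by simpa⟩ ⟨e.symm y0, by simpa, by simpa⟩
  exact ⟨e x1, e y1, a1, a2, a3, a4, (hadj _ _).2 (Or.inl a5)⟩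

theorem noCut_ev {V W : Type u} {G : SimpleGraph V} {G' : SimpleGraph W} (h4 : 4 ≤ Nat.card V)
    (h : NoCut G) (hop : IsEVAdd G G') : 4 ≤ Nat.card W ∧ NoCut G' := by
  obtain ⟨f, v, a, b, w, hfv, hsurj, hab, hwa, hwb, hadj, hv⟩ := hop
  have hV : Finite V := (Nat.card_pos_iff.1 (by omega)).2
  have hW : Finite W := fin_of_surj f v v (fun z => by have := hsurj z; tauto)
  refine ⟨h4.trans (Nat.card_le_card_of_injective f f.injective), ?_⟩
  -- the case where `v` lies on the first side
  have key : ∀ X S : Set W, S.ncard ≤ 2 → v ∈ X → v ∉ S → (∃ y, y ∉ X ∧ y ∉ S) →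
      ∃ x y, x ∈ X ∧ x ∉ S ∧ y ∉ X ∧ y ∉ S ∧ G'.Adj x y := by
    rintro X S hS hvX hvS ⟨y0, hy, hyS⟩
    by_contra! hc
    have hvn : ∀ x, (x = a ∨ x = b ∨ x = w) → f x ∈ X ∨ f x ∈ S := by
      intro x hx
      by_contra! hcon
      exact hc v (f x) hvX hvS hcon.1 hcon.2 ((hv x).2 hx)
    have hx1 : ∃ x, f x ∈ X ∧ f x ∉ S := by
      by_contra! hcon
      have hh : ∀ x, (x = a ∨ x = b ∨ x = w) → f x ∈ S := fun x hx =>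
        (hvn x hx).elim (hcon x) id
      exact three_not_le S hS (f a) (f b) (f w) (f.injective.ne hab.ne)
        (f.injective.ne hwa.symm) (f.injective.ne hwb.symm) (hh a (by simp)) (hh b (by simp))
        (hh w (by simp))
    obtain ⟨y1, rfl⟩ : ∃ y1, f y1 = y0 := by
      rcases hsurj y0 with rfl | h'
      · exact absurd hvX hy
      · exact h'
    have hS1 := pre_ncard f S ∅ (by simp) (by simp)
    obtain ⟨x2, y2, c1, c2, c3, c4, c5⟩ := h (f ⁻¹' X) (f ⁻¹' S) (by omega) hx1 ⟨y1, hy, hyS⟩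
    refine hc _ _ c1 c2 c3 c4 ((hadj x2 y2).2 ⟨c5, ?_⟩)
    intro heq
    have : y2 = a ∨ y2 = b := by
      rw [Sym2.eq_iff] at heq; tauto
    rcases hvn y2 (by tauto) with h' | h'
    · exact c3 h'
    · exact c4 h'
  rintro X S hS ⟨x0, hx, hxS⟩ ⟨y0, hy, hyS⟩
  by_cases hvS : v ∈ S
  · have hS1 := pre_ncard f S {v} (by simpa) (by simpa using hfv)
    rw [Set.ncard_singleton] at hS1
    obtain ⟨x1, rfl⟩ : ∃ x1, f x1 = x0 := by
      rcases hsurj x0 with rfl | h'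
      · exact absurd hvS hxS
      · exact h'
    obtain ⟨y1, rfl⟩ : ∃ y1, f y1 = y0 := by
      rcases hsurj y0 with rfl | h'
      · exact absurd hvS hyS
      · exact h'
    obtain ⟨x2, y2, c1, c2, c3, c4, c5, c6⟩ := cut1 h4 h (f ⁻¹' X) (f ⁻¹' S) (by omega)
      ⟨x1, hx, hxS⟩ ⟨y1, hy, hyS⟩ s(a, b)
    exact ⟨f x2, f y2, c1, c2, c3, c4, (hadj x2 y2).2 ⟨c5, c6⟩⟩
  · by_cases hvX : v ∈ X
    · exact key X S hS hvX hvS ⟨y0, hy, hyS⟩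
    · obtain ⟨x2, y2, c1, c2, c3, c4, c5⟩ := key Xᶜ S hS hvX hvS ⟨x0, by simpa, hxS⟩
      exact ⟨y2, x2, by simpa using c3, c4, c1, c2, c5.symm⟩

theorem noCut_ee {V W : Type u} {G : SimpleGraph V} {G' : SimpleGraph W} (h4 : 4 ≤ Nat.card V)
    (h : NoCut G) (hop : IsEEAdd G G') : 4 ≤ Nat.card W ∧ NoCut G' := by
  obtain ⟨f, v, w, a, b, c, d, hvw, hf, hsurj, hab, hcd, hne, hadj, hv, hw, hadjvw⟩ := hop
  have hV : Finite V := (Nat.card_pos_iff.1 (by omega)).2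
  have hW : Finite W := fin_of_surj f v w hsurj
  refine ⟨h4.trans (Nat.card_le_card_of_injective f f.injective), ?_⟩
  -- one subdivision vertex in the separator, the other on the first side
  have key1 : ∀ (v w : W) (a b c d : V), v ≠ w → (∀ x, f x ≠ v ∧ f x ≠ w) →
      (∀ z : W, z = v ∨ z = w ∨ ∃ x, f x = z) → c ≠ d →
      (∀ x y : V, G'.Adj (f x) (f y) ↔ (G.Adj x y ∧ s(x, y) ≠ s(a, b) ∧ s(x, y) ≠ s(c, d))) →
      (∀ x : V, G'.Adj w (f x) ↔ (x = c ∨ x = d)) →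
      ∀ X S : Set W, S.ncard ≤ 2 → v ∈ S → w ∈ X → w ∉ S → (∃ y, y ∉ X ∧ y ∉ S) →
      ∃ x y, x ∈ X ∧ x ∉ S ∧ y ∉ X ∧ y ∉ S ∧ G'.Adj x y := by
    rintro v w a b c d hvw hf hsurj hcd hadj hw X S hS hvS hwX hwS ⟨y0, hy, hyS⟩
    by_contra! hc
    have hvn : ∀ x, (x = c ∨ x = d) → f x ∈ X ∨ f x ∈ S := by
      intro x hx
      by_contra! hcon
      exact hc w (f x) hwX hwS hcon.1 hcon.2 ((hw x).2 hx)
    have hx1 : ∃ x, f x ∈ X ∧ f x ∉ S := by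
      by_contra! hcon
      have hh : ∀ x, (x = c ∨ x = d) → f x ∈ S := fun x hx =>
        (hvn x hx).elim (hcon x) id
      exact three_not_le S hS (f c) (f d) v (f.injective.ne hcd)
        (hf c).1 (hf d).1 (hh c (by simp)) (hh d (by simp)) hvS
    obtain ⟨y1, rfl⟩ : ∃ y1, f y1 = y0 := by
      rcases hsurj y0 with rfl | rfl | h'
      · exact absurd hvS hyS
      · exact absurd hwX hy
      · exact h'
    have hS1 := pre_ncard f S {v} (by simpa) (by simpa using fun x => (hf x).1)
    rw [Set.ncard_singleton] at hS1
    obtain ⟨x2, y2, c1, c2, c3, c4, c5, c6⟩ := cut1 h4 h (f ⁻¹' X) (f ⁻¹' S) (by omega) hx1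
      ⟨y1, hy, hyS⟩ s(a, b)
    refine hc _ _ c1 c2 c3 c4 ((hadj x2 y2).2 ⟨c5, c6, ?_⟩)
    intro heq
    have : y2 = c ∨ y2 = d := by
      rw [Sym2.eq_iff] at heq; tauto
    rcases hvn y2 this with h' | h'
    · exact c3 h'
    · exact c4 h'
  have key2 : ∀ X S : Set W, S.ncard ≤ 2 → v ∈ X → v ∉ S → w ∈ X → w ∉ S →
      (∃ y, y ∉ X ∧ y ∉ S) →
      ∃ x y, x ∈ X ∧ x ∉ S ∧ y ∉ X ∧ y ∉ S ∧ G'.Adj x y := by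
    rintro X S hS hvX hvS hwX hwS ⟨y0, hy, hyS⟩
    by_contra! hc
    have hvn : ∀ x, (x = a ∨ x = b ∨ x = c ∨ x = d) → f x ∈ X ∨ f x ∈ S := by
      intro x hx
      by_contra! hcon
      by_cases hx' : x = a ∨ x = b
      · exact hc v (f x) hvX hvS hcon.1 hcon.2 ((hv x).2 hx')
      · exact hc w (f x) hwX hwS hcon.1 hcon.2 ((hw x).2 (by tauto))
    have hx1 : ∃ x, f x ∈ X ∧ f x ∉ S := by
      by_contra! hcon
      have hh : ∀ x, (x = a ∨ x = b ∨ x = c ∨ x = d) → f x ∈ S := fun x hx =>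
        (hvn x hx).elim (hcon x) id
      have h3 : ∀ x, (x = c ∨ x = d) → x = a ∨ x = b := by
        intro x hx
        by_contra! hcon
        exact three_not_le S hS (f a) (f b) (f x) (f.injective.ne hab.ne)
          (f.injective.ne hcon.1.symm) (f.injective.ne hcon.2.symm)
          (hh a (by simp)) (hh b (by simp)) (hh x (by tauto))
      have h5 := h3 c (by simp)
      have h6 := h3 d (by simp)
      have h7 := hcd.ne
      apply hne
      rw [Sym2.eq_iff]
      grind
    obtain ⟨y1, rfl⟩ : ∃ y1, f y1 = y0 := by
      rcases hsurj y0 with rfl | rfl | h'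
      · exact absurd hvX hy
      · exact absurd hwX hy
      · exact h'
    have hS1 := pre_ncard f S ∅ (by simp) (by simp)
    obtain ⟨x2, y2, c1, c2, c3, c4, c5⟩ := h (f ⁻¹' X) (f ⁻¹' S) (by omega) hx1 ⟨y1, hy, hyS⟩
    have hy2 : ¬ (y2 = a ∨ y2 = b ∨ y2 = c ∨ y2 = d) := by
      intro h'
      rcases hvn y2 h' with h' | h'
      · exact c3 h'
      · exact c4 h'
    refine hc _ _ c1 c2 c3 c4 ((hadj x2 y2).2 ⟨c5, ?_, ?_⟩)
    · intro heq
      rw [Sym2.eq_iff] at heq; tauto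
    · intro heq
      rw [Sym2.eq_iff] at heq; tauto
  rintro X S hS ⟨x0, hx, hxS⟩ ⟨y0, hy, hyS⟩
  have flip : (∃ x y, x ∈ Xᶜ ∧ x ∉ S ∧ y ∉ Xᶜ ∧ y ∉ S ∧ G'.Adj x y) →
      ∃ x y, x ∈ X ∧ x ∉ S ∧ y ∉ X ∧ y ∉ S ∧ G'.Adj x y := by
    rintro ⟨x2, y2, c1, c2, c3, c4, c5⟩
    exact ⟨y2, x2, by simpa using c3, c4, c1, c2, c5.symm⟩
  have hf' : ∀ x, f x ≠ w ∧ f x ≠ v := fun x => (hf x).symm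
  have hsurj' : ∀ z : W, z = w ∨ z = v ∨ ∃ x, f x = z := fun z => by
    have := hsurj z; tauto
  have hadj' : ∀ x y : V, G'.Adj (f x) (f y) ↔
      (G.Adj x y ∧ s(x, y) ≠ s(c, d) ∧ s(x, y) ≠ s(a, b)) := fun x y => by
    rw [hadj]; tauto
  by_cases hvS : v ∈ S
  · by_cases hwS : w ∈ S
    · have hS1 := pre_ncard f S {v, w} (by rintro z (rfl | rfl) <;> assumption)
        (by intro x; have := hf x; simp [this.1, this.2])
      rw [Set.ncard_pair hvw] at hS1
      have hS0 : f ⁻¹' S = ∅ := by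
        rw [← Set.ncard_eq_zero]; omega
      have hnS : ∀ x, f x ∉ S := fun x hx => by
        have : x ∈ f ⁻¹' S := hx
        rw [hS0] at this; exact this
      obtain ⟨x1, rfl⟩ : ∃ x1, f x1 = x0 := by
        rcases hsurj x0 with rfl | rfl | h'
        · exact absurd hvS hxS
        · exact absurd hwS hxS
        · exact h'
      obtain ⟨y1, rfl⟩ : ∃ y1, f y1 = y0 := by
        rcases hsurj y0 with rfl | rfl | h'
        · exact absurd hvS hyS
        · exact absurd hwS hyS
        · exact h'
      obtain ⟨x2, y2, c1, c3, c5, c6, c7⟩ := cut2 h4 h (f ⁻¹' X)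
        ⟨x1, hx⟩ ⟨y1, hy⟩ s(a, b) s(c, d)
      exact ⟨f x2, f y2, c1, hnS _, c3, hnS _, (hadj x2 y2).2 ⟨c5, c6, c7⟩⟩
    · by_cases hwX : w ∈ X
      · exact key1 v w a b c d hvw hf hsurj hcd.ne hadj hw X S hS hvS hwX hwS ⟨y0, hy, hyS⟩
      · exact flip (key1 v w a b c d hvw hf hsurj hcd.ne hadj hw Xᶜ S hS hvS hwX hwS
          ⟨x0, by simpa, hxS⟩)
  · by_cases hwS : w ∈ S
    · by_cases hvX : v ∈ X
      · exact key1 w v c d a b hvw.symm hf' hsurj' hab.ne hadj' hv X S hS hwS hvX hvS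
          ⟨y0, hy, hyS⟩
      · exact flip (key1 w v c d a b hvw.symm hf' hsurj' hab.ne hadj' hv Xᶜ S hS hwS hvX hvS
          ⟨x0, by simpa, hxS⟩)
    · by_cases hvX : v ∈ X
      · by_cases hwX : w ∈ X
        · exact key2 X S hS hvX hvS hwX hwS ⟨y0, hy, hyS⟩
        · exact ⟨v, w, hvX, hvS, hwX, hwS, hadjvw⟩
      · by_cases hwX : w ∈ X
        · exact ⟨w, v, hwX, hwS, hvX, hvS, hadjvw.symm⟩
        · exact flip (key2 Xᶜ S hS hvX hvS hwX hwS ⟨x0, by simpa, hxS⟩)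

theorem noCut_of_constructible {A : Σ V : Type u, SimpleGraph V} (h : BGConstructible A) :
    4 ≤ Nat.card A.1 ∧ NoCut A.2 := by
  induction h with
  | base G h =>
    obtain ⟨e⟩ := h
    refine ⟨by rw [Nat.card_congr e.toEquiv]; simp, ?_⟩
    rintro X S hS ⟨x0, hx, hxS⟩ ⟨y0, hy, hyS⟩
    refine ⟨x0, y0, hx, hxS, hy, hyS, ?_⟩
    rw [← e.map_adj_iff]
    intro heq
    have := e.injective heq
    exact hy (this ▸ hx)
  | step G G' hG hop ih =>
    obtain ⟨h4, h⟩ := ih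
    rcases hop with hop | hop | hop
    · refine ⟨?_, noCut_vv h hop⟩
      obtain ⟨e, -⟩ := hop
      rw [← Nat.card_congr e]; exact h4
    · exact noCut_ev h4 h hop
    · exact noCut_ee h4 h hop


section Sub

variable {V : Type u}

/-- Add the edge `xy`. -/
def addE (H : SimpleGraph V) (x y : V) : SimpleGraph V where
  Adj u v := H.Adj u v ∨ (u ≠ v ∧ ((u = x ∧ v = y) ∨ (u = y ∧ v = x)))
  symm := ⟨by intro u v h; have := H.adj_comm u v; grind⟩
  loopless := ⟨by intro u h; have := H.irrefl (v := u); tauto⟩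

/-- Subdivide the edge `pq` by the vertex `t`. -/
def sub (H : SimpleGraph V) (p q t : V) : SimpleGraph V where
  Adj u v := (H.Adj u v ∧ ¬ ((u = p ∧ v = q) ∨ (u = q ∧ v = p))) ∨
    (u ≠ v ∧ ((u = t ∧ (v = p ∨ v = q)) ∨ (v = t ∧ (u = p ∨ u = q))))
  symm := ⟨by intro u v h; have := H.adj_comm u v; grind⟩
  loopless := ⟨by intro u h; have := H.irrefl (v := u); tauto⟩

theorem addE_adj (H : SimpleGraph V) (x y u v : V) : (addE H x y).Adj u v ↔
    H.Adj u v ∨ (u ≠ v ∧ ((u = x ∧ v = y) ∨ (u = y ∧ v = x))) := Iff.rfl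

theorem sub_adj (H : SimpleGraph V) (p q t u v : V) : (sub H p q t).Adj u v ↔
    (H.Adj u v ∧ ¬ ((u = p ∧ v = q) ∨ (u = q ∧ v = p))) ∨
    (u ≠ v ∧ ((u = t ∧ (v = p ∨ v = q)) ∨ (v = t ∧ (u = p ∨ u = q)))) := Iff.rfl

theorem sub_comm' (H : SimpleGraph V) (p q t : V) : sub H p q t = sub H q p t := by
  ext u v
  simp only [sub_adj]
  tauto

theorem addE_comm' (H : SimpleGraph V) (p q : V) : addE H p q = addE H q p := by
  ext u v
  simp only [addE_adj]
  tauto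

/-- `t` is isolated. -/
def Iso (H : SimpleGraph V) (t : V) : Prop := ∀ u, ¬ H.Adj t u

theorem not_iso {H : SimpleGraph V} {t : V} : ¬ Iso H t ↔ ∃ u, H.Adj t u := by
  simp [Iso]

/-- The non-isolated part of `H` is BG-constructible. -/
def Bc (H : SimpleGraph V) : Prop :=
  ∀ (W : Type u) (K : SimpleGraph W) (f : W ↪ V), (∀ z, (∃ x, f x = z) ↔ ¬ Iso H z) →
    (∀ x y, K.Adj x y ↔ H.Adj (f x) (f y)) → BGConstructible ⟨W, K⟩

theorem bc_vv {H : SimpleGraph V} (h : Bc H) {x y : V} (hx : ¬ Iso H x) (hy : ¬ Iso H y)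
    (hxy : x ≠ y) (hn : ¬ H.Adj x y) : Bc (addE H x y) := by
  intro W K f hf hK
  have hiso : ∀ z, Iso (addE H x y) z ↔ Iso H z := by
    intro z
    rw [← not_iff_not, not_iso, not_iso]
    rw [not_iso] at hx hy
    constructor
    · rintro ⟨u, hu⟩
      rw [addE_adj] at hu
      grind
    · rintro ⟨u, hu⟩
      exact ⟨u, Or.inl hu⟩
  have hf' : ∀ z, (∃ x, f x = z) ↔ ¬ Iso H z := fun z => by rw [hf, hiso]
  have h1 := h W (H.comap f) f hf' (fun _ _ => Iff.rfl)
  obtain ⟨x', rfl⟩ := (hf' x).2 hx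
  obtain ⟨y', rfl⟩ := (hf' y).2 hy
  refine BGConstructible.step _ K h1 (Or.inl ⟨Equiv.refl W, x', y', ?_, hn, ?_⟩)
  · rintro rfl; exact hxy rfl
  · intro z z'
    simp only [Equiv.refl_apply]
    rw [hK, addE_adj]
    simp only [SimpleGraph.comap_adj, f.injective.eq_iff, ne_eq]
    have : x' ≠ y' := by rintro rfl; exact hxy rfl
    grind

theorem bc_ev {H : SimpleGraph V} (h : Bc H) {a b t y : V} (hab : H.Adj a b) (hy : ¬ Iso H y)
    (hya : y ≠ a) (hyb : y ≠ b) (ht : Iso H t) : Bc (addE (sub H a b t) t y) := by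
  intro W K f hf hK
  have hiso : ∀ z, ¬ Iso (addE (sub H a b t) t y) z ↔ (z = t ∨ ¬ Iso H z) := by
    intro z
    rw [not_iso, not_iso]
    simp only [addE_adj, sub_adj]
    rw [not_iso] at hy
    obtain ⟨y', hy⟩ := hy
    have hta : t ≠ a := by rintro rfl; exact ht _ hab
    have htb : t ≠ b := by rintro rfl; exact ht _ hab.symm
    constructor
    · rintro ⟨u, hu⟩
      have := hab.symm
      grind
    · rintro (rfl | ⟨u, hu⟩)
      · exact ⟨a, by grind⟩
      · by_cases h1 : (z = a ∧ u = b) ∨ (z = b ∧ u = a)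
        · exact ⟨t, by grind⟩
        · exact ⟨u, by grind⟩
  have hty : t ≠ y := by rintro rfl; exact hy ht
  have hta : t ≠ a := by rintro rfl; exact ht _ hab
  have htb : t ≠ b := by rintro rfl; exact ht _ hab.symm
  have hf1 : ∀ z, (∃ x : {x : W // f x ≠ t}, f x.1 = z) ↔ ¬ Iso H z := by
    intro z
    constructor
    · rintro ⟨⟨x, hx⟩, rfl⟩
      have := (hiso _).1 ((hf _).1 ⟨x, rfl⟩)
      tauto
    · intro hz
      obtain ⟨x, rfl⟩ := (hf z).2 ((hiso z).2 (Or.inr hz))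
      refine ⟨⟨x, ?_⟩, rfl⟩
      intro h'
      rw [h'] at hz
      exact hz ht
  have h1 := h {x : W // f x ≠ t} (H.comap (fun x => f x.1))
    ((Function.Embedding.subtype _).trans f) hf1 (fun _ _ => Iff.rfl)
  obtain ⟨t', ht'⟩ := (hf t).2 ((hiso t).2 (Or.inl rfl))
  obtain ⟨a', rfl⟩ := (hf1 a).2 (not_iso.2 ⟨_, hab⟩)
  obtain ⟨b', rfl⟩ := (hf1 b).2 (not_iso.2 ⟨_, hab.symm⟩)
  obtain ⟨y', rfl⟩ := (hf1 y).2 hy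
  refine BGConstructible.step _ K h1 (Or.inr (Or.inl ⟨Function.Embedding.subtype _, t', a', b', y',
    ?_, ?_, hab, ?_, ?_, ?_, ?_⟩))
  · rintro ⟨x, hx⟩ rfl
    exact hx ht'
  · intro z
    by_cases hz : f z = t
    · exact Or.inl (f.injective (hz.trans ht'.symm))
    · exact Or.inr ⟨⟨z, hz⟩, rfl⟩
  · rintro rfl; exact hya rfl
  · rintro rfl; exact hyb rfl
  · rintro ⟨x, hx⟩ ⟨z, hz⟩
    rw [hK, addE_adj, sub_adj]
    simp only [Function.Embedding.subtype_apply, SimpleGraph.comap_adj, ne_eq, Sym2.eq_iff,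
      Subtype.ext_iff, f.injective.eq_iff]
    grind
  · rintro ⟨x, hx⟩
    rw [hK, addE_adj, sub_adj, ht']
    simp only [Function.Embedding.subtype_apply,
      Subtype.ext_iff, f.injective.eq_iff]
    have := ht (f x)
    grind

theorem bc_ee {H : SimpleGraph V} (h : Bc H) {a b c d t u : V} (hab : H.Adj a b) (hcd : H.Adj c d)
    (hne : s(a, b) ≠ s(c, d)) (ht : Iso H t) (hu : Iso H u) (htu : t ≠ u) :
    Bc (addE (sub (sub H a b t) c d u) t u) := by
  intro W K f hf hK
  have hta : t ≠ a := by rintro rfl; exact ht _ hab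
  have htb : t ≠ b := by rintro rfl; exact ht _ hab.symm
  have htc : t ≠ c := by rintro rfl; exact ht _ hcd
  have htd : t ≠ d := by rintro rfl; exact ht _ hcd.symm
  have hua : u ≠ a := by rintro rfl; exact hu _ hab
  have hub : u ≠ b := by rintro rfl; exact hu _ hab.symm
  have huc : u ≠ c := by rintro rfl; exact hu _ hcd
  have hud : u ≠ d := by rintro rfl; exact hu _ hcd.symm
  have hiso : ∀ z, ¬ Iso (addE (sub (sub H a b t) c d u) t u) z ↔ (z = t ∨ z = u ∨ ¬ Iso H z) := by
    intro z
    rw [not_iso, not_iso]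
    simp only [addE_adj, sub_adj]
    constructor
    · rintro ⟨u, hu⟩
      have := hab.symm
      have := hcd.symm
      grind
    · rintro (rfl | rfl | ⟨v, hv⟩)
      · exact ⟨u, by grind⟩
      · exact ⟨t, by grind⟩
      · by_cases h1 : (z = a ∧ v = b) ∨ (z = b ∧ v = a)
        · exact ⟨t, by grind⟩
        · by_cases h1 : (z = c ∧ v = d) ∨ (z = d ∧ v = c)
          · exact ⟨u, by grind⟩
          · exact ⟨v, by grind⟩
  have hf1 : ∀ z, (∃ x : {x : W // f x ≠ t ∧ f x ≠ u}, f x.1 = z) ↔ ¬ Iso H z := by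
    intro z
    constructor
    · rintro ⟨⟨x, hx⟩, rfl⟩
      have := (hiso _).1 ((hf _).1 ⟨x, rfl⟩)
      tauto
    · intro hz
      obtain ⟨x, rfl⟩ := (hf z).2 ((hiso z).2 (Or.inr (Or.inr hz)))
      refine ⟨⟨x, ?_, ?_⟩, rfl⟩
      · intro h'
        rw [h'] at hz
        exact hz ht
      · intro h'
        rw [h'] at hz
        exact hz hu
  have h1 := h {x : W // f x ≠ t ∧ f x ≠ u} (H.comap (fun x => f x.1))
    ((Function.Embedding.subtype _).trans f) hf1 (fun _ _ => Iff.rfl)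
  obtain ⟨t', ht'⟩ := (hf t).2 ((hiso t).2 (Or.inl rfl))
  obtain ⟨u', hu'⟩ := (hf u).2 ((hiso u).2 (Or.inr (Or.inl rfl)))
  obtain ⟨a', rfl⟩ := (hf1 a).2 (not_iso.2 ⟨_, hab⟩)
  obtain ⟨b', rfl⟩ := (hf1 b).2 (not_iso.2 ⟨_, hab.symm⟩)
  obtain ⟨c', rfl⟩ := (hf1 c).2 (not_iso.2 ⟨_, hcd⟩)
  obtain ⟨d', rfl⟩ := (hf1 d).2 (not_iso.2 ⟨_, hcd.symm⟩)
  refine BGConstructible.step _ K h1 (Or.inr (Or.inr ⟨Function.Embedding.subtype _, t', u',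
    a', b', c', d', ?_, ?_, ?_, hab, hcd, ?_, ?_, ?_, ?_, ?_⟩))
  · rintro rfl; exact htu (ht'.symm.trans hu')
  · rintro ⟨x, hx⟩
    constructor
    · rintro rfl; exact hx.1 ht'
    · rintro rfl; exact hx.2 hu'
  · intro z
    by_cases hz : f z = t
    · exact Or.inl (f.injective (hz.trans ht'.symm))
    by_cases hz2 : f z = u
    · exact Or.inr (Or.inl (f.injective (hz2.trans hu'.symm)))
    · exact Or.inr (Or.inr ⟨⟨z, hz, hz2⟩, rfl⟩)
  · intro h'
    apply hne
    rw [Sym2.eq_iff] at h' ⊢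
    grind
  · rintro ⟨x, hx⟩ ⟨z, hz⟩
    rw [hK, addE_adj, sub_adj, sub_adj]
    simp only [Function.Embedding.subtype_apply, SimpleGraph.comap_adj, ne_eq, Sym2.eq_iff,
      Subtype.ext_iff, f.injective.eq_iff]
    grind
  · rintro ⟨x, hx⟩
    rw [hK, addE_adj, sub_adj, sub_adj, ht']
    simp only [Function.Embedding.subtype_apply,
      Subtype.ext_iff, f.injective.eq_iff]
    have := ht (f x)
    grind
  · rintro ⟨x, hx⟩
    rw [hK, addE_adj, sub_adj, sub_adj, hu']
    simp only [Function.Embedding.subtype_apply,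
      Subtype.ext_iff, f.injective.eq_iff]
    have := hu (f x)
    grind
  · rw [hK, addE_adj, ht', hu']
    exact Or.inr ⟨htu, Or.inl ⟨rfl, rfl⟩⟩

open Classical in
/-- The colouring of a subdivided graph. -/
noncomputable def subc (c : Sym2 V → Sym2 V) (p q t : V) : Sym2 V → Sym2 V :=
  fun e => if e = s(t, p) ∨ e = s(t, q) then c s(p, q) else c e

/-- `H` is a subdivision of a BG-constructible graph, `c` colours the links. -/
inductive R : SimpleGraph V → (Sym2 V → Sym2 V) → Prop
  | base (H : SimpleGraph V) (c : Sym2 V → Sym2 V) (h : Bc H)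
      (hc : ∀ a b a' b', H.Adj a b → H.Adj a' b' → c s(a, b) = c s(a', b') → s(a, b) = s(a', b')) :
      R H c
  | sub (H : SimpleGraph V) (c : Sym2 V → Sym2 V) (p q t : V) (h : R H c) (hpq : H.Adj p q)
      (ht : Iso H t) : R (sub H p q t) (subc c p q t)

/-- `H` is a subdivision of a BG-constructible graph. -/
def Rr (H : SimpleGraph V) : Prop := ∃ c, R H c

theorem Rr.base {H : SimpleGraph V} (h : Bc H) : Rr H :=
  ⟨id, R.base H id h (fun _ _ _ _ _ _ h => h)⟩

theorem Rr.sub {H : SimpleGraph V} (h : Rr H) {p q t : V} (hpq : H.Adj p q) (ht : Iso H t) :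
    Rr (sub H p q t) := by
  obtain ⟨c, h⟩ := h
  exact ⟨_, R.sub H c p q t h hpq ht⟩

theorem ee_lemma {H : SimpleGraph V} {c : Sym2 V → Sym2 V} (h : R H c) :
    ∀ a b a' b' v w, H.Adj a b → H.Adj a' b' → c s(a, b) ≠ c s(a', b') → v ≠ w → Iso H v →
    Iso H w → Rr (addE (sub (sub H a b v) a' b' w) v w) := by
  induction h with
  | base H c h hc =>
    intro a b a' b' v w hab hab' hne hvw hv hw
    refine Rr.base (bc_ee h hab hab' ?_ hv hw hvw)
    intro h'; rw [h'] at hne; exact hne rfl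
  | sub H c p q t h hpq ht ih =>
    -- the second edge avoids `t`; the first one is arbitrary
    have key : ∀ a b a' b' v w, (sub H p q t).Adj a b → H.Adj a' b' → s(a', b') ≠ s(p, q) →
        subc c p q t s(a, b) ≠ c s(a', b') → v ≠ w → Iso (sub H p q t) v →
        Iso (sub H p q t) w → Rr (addE (sub (sub (sub H p q t) a b v) a' b' w) v w) := by
      have htp : t ≠ p := by rintro rfl; exact ht _ hpq
      have htq : t ≠ q := by rintro rfl; exact ht _ hpq.symm
      have key0 : ∀ p q a' b' v w, H.Adj p q → t ≠ p → t ≠ q → H.Adj a' b' → s(a', b') ≠ s(p, q) →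
        c s(p, q) ≠ c s(a', b') → v ≠ w → Iso (sub H p q t) v →
        Iso (sub H p q t) w → Rr (addE (sub (sub (sub H p q t) t p v) a' b' w) v w) := by
        intro p q a' b' v w hpq htp htq hab' hne' hne hvw hv hw
        have hvt : v ≠ t := by
          rintro rfl; exact hv p (by simp [sub_adj, htp])
        have hwt : w ≠ t := by
          rintro rfl; exact hw p (by simp [sub_adj, htp])
        have hv' : Iso H v := by
          intro u hu
          by_cases h1 : (v = p ∧ u = q) ∨ (v = q ∧ u = p)
          · exact hv t (by grind [sub_adj])
          · exact hv u (by grind [sub_adj])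
        have hw' : Iso H w := by
          intro u hu
          by_cases h1 : (w = p ∧ u = q) ∨ (w = q ∧ u = p)
          · exact hw t (by grind [sub_adj])
          · exact hw u (by grind [sub_adj])
        have hvp : v ≠ p := by rintro rfl; exact hv' _ hpq
        have hvq : v ≠ q := by rintro rfl; exact hv' _ hpq.symm
        have hwp : w ≠ p := by rintro rfl; exact hw' _ hpq
        have hwq : w ≠ q := by rintro rfl; exact hw' _ hpq.symm
        have hta : t ≠ a' := by rintro rfl; exact ht _ hab'
        have htb : t ≠ b' := by rintro rfl; exact ht _ hab'.symm
        have hva : v ≠ a' := by rintro rfl; exact hv' _ hab'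
        have hvb : v ≠ b' := by rintro rfl; exact hv' _ hab'.symm
        have hwa : w ≠ a' := by rintro rfl; exact hw' _ hab'
        have hwb : w ≠ b' := by rintro rfl; exact hw' _ hab'.symm
        have h1 := ih p q a' b' v w hpq hab' hne hvw hv' hw'
        have hne'' : ¬ ((a' = p ∧ b' = q) ∨ (a' = q ∧ b' = p)) := by
          rwa [← Sym2.eq_iff]
        have h2 : Rr (BGProof.sub _ q v t) := h1.sub (p := q) (q := v) (t := t)
          (by simp only [addE_adj, sub_adj]; grind)
          (by intro u; have := ht u; simp only [addE_adj, sub_adj]; grind)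
        convert h2 using 1
        ext x y
        have := ht x
        have := ht y
        have := H.adj_comm x y
        simp only [addE_adj, sub_adj]
        have hta' := ht a'
        have := hv' x
        have := hv' y
        have := hw' x
        have := hw' y
        have hpqn := hpq.ne
        clear h2 h1 ih hw' hv' hv hw ht hne' hne h
        grind (splits := 40)
      intro a b a' b' v w hab hab' hne' hne hvw hv hw
      have hcol : (a = t ∨ b = t) → c s(p, q) ≠ c s(a', b') := by
        intro hat
        have : s(a, b) = s(t, p) ∨ s(a, b) = s(t, q) := by
          have := ht a; have := ht b; have := H.adj_comm a b
          simp only [Sym2.eq_iff]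
          rw [sub_adj] at hab
          grind
        rw [subc, if_pos this] at hne
        exact hne
      by_cases hat : a = t ∨ b = t
      · replace hcol := hcol hat
        have hcases : (a = t ∧ b = p) ∨ (a = t ∧ b = q) ∨ (a = p ∧ b = t) ∨ (a = q ∧ b = t) := by
          have := ht a; have := ht b; have := H.adj_comm a b
          rw [sub_adj] at hab
          grind
        rcases hcases with ⟨rfl, rfl⟩ | ⟨rfl, rfl⟩ | ⟨rfl, rfl⟩ | ⟨rfl, rfl⟩
        · exact key0 _ _ _ _ _ _ hpq htp htq hab' hne' hcol hvw hv hw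
        · rw [sub_comm' H] at hv hw ⊢
          exact key0 _ _ _ _ _ _ hpq.symm htq htp hab' (by rwa [Sym2.eq_swap (a := b)])
            (by rwa [Sym2.eq_swap (a := b)]) hvw hv hw
        · rw [sub_comm' (BGProof.sub H _ _ _)]
          exact key0 _ _ _ _ _ _ hpq htp htq hab' hne' hcol hvw hv hw
        · rw [sub_comm' (BGProof.sub H _ _ _), sub_comm' H]
          rw [sub_comm' H] at hv hw
          exact key0 _ _ _ _ _ _ hpq.symm htq htp hab' (by rwa [Sym2.eq_swap (a := a)])
            (by rwa [Sym2.eq_swap (a := a)]) hvw hv hw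
      · push Not at hat
        have hab1 : H.Adj a b ∧ ¬ ((a = p ∧ b = q) ∨ (a = q ∧ b = p)) := by
          rw [sub_adj] at hab
          grind
        have hcol1 : c s(a, b) ≠ c s(a', b') := by
          rw [subc, if_neg] at hne
          · exact hne
          · simp only [Sym2.eq_iff]; grind
        have hvt : v ≠ t := by
          rintro rfl; exact hv p (by simp [sub_adj, htp])
        have hwt : w ≠ t := by
          rintro rfl; exact hw p (by simp [sub_adj, htp])
        have hv' : Iso H v := by
          intro u hu
          by_cases h1 : (v = p ∧ u = q) ∨ (v = q ∧ u = p)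
          · exact hv t (by grind [sub_adj])
          · exact hv u (by grind [sub_adj])
        have hw' : Iso H w := by
          intro u hu
          by_cases h1 : (w = p ∧ u = q) ∨ (w = q ∧ u = p)
          · exact hw t (by grind [sub_adj])
          · exact hw u (by grind [sub_adj])
        have hvp : v ≠ p := by rintro rfl; exact hv' _ hpq
        have hvq : v ≠ q := by rintro rfl; exact hv' _ hpq.symm
        have hwp : w ≠ p := by rintro rfl; exact hw' _ hpq
        have hwq : w ≠ q := by rintro rfl; exact hw' _ hpq.symm
        have hta : t ≠ a' := by rintro rfl; exact ht _ hab'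
        have htb : t ≠ b' := by rintro rfl; exact ht _ hab'.symm
        have h1 := ih a b a' b' v w hab1.1 hab' hcol1 hvw hv' hw'
        have hne'' : ¬ ((a' = p ∧ b' = q) ∨ (a' = q ∧ b' = p)) := by
          rwa [← Sym2.eq_iff]
        have h2 : Rr (BGProof.sub _ p q t) := h1.sub (p := p) (q := q) (t := t)
          (by simp only [addE_adj, sub_adj]; grind)
          (by intro u; have := ht u; simp only [addE_adj, sub_adj]; grind)
        convert h2 using 1
        ext x y
        have := ht x
        have := ht y
        have := H.adj_comm x y
        simp only [addE_adj, sub_adj]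
        have := hv' x
        have := hv' y
        have := hw' x
        have := hw' y
        have hab2 := hab1.2
        have hva : v ≠ a := by rintro rfl; exact hv' _ hab1.1
        have hvb : v ≠ b := by rintro rfl; exact hv' _ hab1.1.symm
        have hwa : w ≠ a := by rintro rfl; exact hw' _ hab1.1
        have hwb : w ≠ b := by rintro rfl; exact hw' _ hab1.1.symm
        have hva' : v ≠ a' := by rintro rfl; exact hv' _ hab'
        have hvb' : v ≠ b' := by rintro rfl; exact hv' _ hab'.symm
        have hwa' : w ≠ a' := by rintro rfl; exact hw' _ hab'
        have hwb' : w ≠ b' := by rintro rfl; exact hw' _ hab'.symm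
        clear h2 h1 ih hw' hv' hv hw ht hne' hne h key0 hcol hcol1 hab hab1
        grind (splits := 40)
    intro a b a' b' v w hab hab' hne hvw hv hw
    by_cases hat' : a' = t ∨ b' = t
    · have hcol' : subc c p q t s(a', b') = c s(p, q) := by
        rw [subc, if_pos]
        have := ht a'; have := ht b'; have := H.adj_comm a' b'
        simp only [Sym2.eq_iff]
        rw [sub_adj] at hab'
        grind
      have hat : a ≠ t ∧ b ≠ t := by
        by_contra hcon
        apply hne
        rw [hcol', subc, if_pos]
        have := ht a; have := ht b; have := H.adj_comm a b
        simp only [Sym2.eq_iff]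
        rw [sub_adj] at hab
        grind
      have hab1 : H.Adj a b ∧ ¬ ((a = p ∧ b = q) ∨ (a = q ∧ b = p)) := by
        rw [sub_adj] at hab
        grind
      have hcol1 : subc c p q t s(a, b) = c s(a, b) := by
        rw [subc, if_neg]
        simp only [Sym2.eq_iff]; grind
      have h1 := key a' b' a b w v hab' hab1.1 (by rw [Ne, Sym2.eq_iff]; exact hab1.2)
        (by rw [← hcol1]; exact hne.symm) hvw.symm hw hv
      convert h1 using 1
      have h2 : s(a, b) ≠ s(a', b') := by
        intro h'; rw [h'] at hne; exact hne rfl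
      rw [Ne, Sym2.eq_iff] at h2
      have hva : v ≠ a' := by rintro rfl; exact hv _ hab'
      have hvb : v ≠ b' := by rintro rfl; exact hv _ hab'.symm
      have hwa : w ≠ a := by rintro rfl; exact hw _ hab
      have hwb : w ≠ b := by rintro rfl; exact hw _ hab.symm
      clear h1 key ih
      ext x y
      generalize BGProof.sub H p q t = H1 at *
      simp only [addE_adj, sub_adj]
      grind
    · have hab1 : H.Adj a' b' ∧ ¬ ((a' = p ∧ b' = q) ∨ (a' = q ∧ b' = p)) := by
        rw [sub_adj] at hab'
        grind
      have hcol1 : subc c p q t s(a', b') = c s(a', b') := by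
        rw [subc, if_neg]
        simp only [Sym2.eq_iff]; grind
      exact key a b a' b' v w hab hab1.1 (by rw [Ne, Sym2.eq_iff]; exact hab1.2)
        (by rw [← hcol1]; exact hne) hvw hv hw

end Sub


section Ev

variable {V : Type u}

/-- The vertex `z` is incident with an edge of colour `γ`. -/
def Co (H : SimpleGraph V) (c : Sym2 V → Sym2 V) (z : V) (γ : Sym2 V) : Prop :=
  ∃ w, H.Adj z w ∧ c s(z, w) = γ

theorem iso_of_sub {H : SimpleGraph V} {p q t z : V}
    (hz : Iso (sub H p q t) z) : Iso H z := by
  intro u hu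
  by_cases h1 : (z = p ∧ u = q) ∨ (z = q ∧ u = p)
  · have hu' := hu.ne
    by_cases hzt : z = t
    · exact hz u (by grind [sub_adj])
    · exact hz t (by grind [sub_adj])
  · exact hz u (by grind [sub_adj])

theorem iso_sub_iff {H : SimpleGraph V} {p q t z : V} (hpq : H.Adj p q) (ht : Iso H t) :
    Iso (sub H p q t) z ↔ Iso H z ∧ z ≠ t := by
  have htp : t ≠ p := by rintro rfl; exact ht _ hpq
  have htq : t ≠ q := by rintro rfl; exact ht _ hpq.symm
  constructor
  · intro h
    refine ⟨iso_of_sub h, ?_⟩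
    rintro rfl
    exact h p (by grind [sub_adj])
  · rintro ⟨h, hzt⟩ u hu
    have hzp : z ≠ p := by rintro rfl; exact h _ hpq
    have hzq : z ≠ q := by rintro rfl; exact h _ hpq.symm
    have := h u
    rw [sub_adj] at hu
    grind

theorem co_sub_t {H : SimpleGraph V} {c : Sym2 V → Sym2 V} {p q t : V} (hpq : H.Adj p q)
    (ht : Iso H t) (γ : Sym2 V) : Co (sub H p q t) (subc c p q t) t γ ↔ γ = c s(p, q) := by
  have htp : t ≠ p := by rintro rfl; exact ht _ hpq
  have htq : t ≠ q := by rintro rfl; exact ht _ hpq.symm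
  constructor
  · rintro ⟨w, hw, rfl⟩
    have : w = p ∨ w = q := by
      have := ht w
      rw [sub_adj] at hw
      grind
    rw [subc, if_pos]
    rcases this with rfl | rfl
    · exact Or.inl rfl
    · exact Or.inr rfl
  · rintro rfl
    refine ⟨p, by grind [sub_adj], ?_⟩
    rw [subc, if_pos (Or.inl rfl)]

theorem co_sub {H : SimpleGraph V} {c : Sym2 V → Sym2 V} {p q t z : V} (hpq : H.Adj p q)
    (ht : Iso H t) (hz : z ≠ t) (γ : Sym2 V) :
    Co (sub H p q t) (subc c p q t) z γ ↔ Co H c z γ := by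
  have htp : t ≠ p := by rintro rfl; exact ht _ hpq
  have htq : t ≠ q := by rintro rfl; exact ht _ hpq.symm
  constructor
  · rintro ⟨w, hw, rfl⟩
    by_cases hwt : w = t
    · have hzz : z = p ∨ z = q := by
        have := ht z
        have := H.adj_comm z w
        rw [sub_adj] at hw
        grind
      rw [subc, if_pos]
      · rcases hzz with rfl | rfl
        · exact ⟨q, hpq, rfl⟩
        · exact ⟨p, hpq.symm, by rw [Sym2.eq_swap]⟩
      · simp only [Sym2.eq_iff]; grind
    · refine ⟨w, ?_, ?_⟩
      · rw [sub_adj] at hw; grind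
      · rw [subc, if_neg]
        simp only [Sym2.eq_iff]; grind
  · rintro ⟨w, hw, rfl⟩
    by_cases h1 : (z = p ∧ w = q) ∨ (z = q ∧ w = p)
    · refine ⟨t, by grind [sub_adj], ?_⟩
      rw [subc, if_pos]
      · rcases h1 with ⟨rfl, rfl⟩ | ⟨rfl, rfl⟩
        · rfl
        · rw [Sym2.eq_swap]
      · simp only [Sym2.eq_iff]; grind
    · have hwt : w ≠ t := by rintro rfl; exact ht _ hw.symm
      refine ⟨w, by grind [sub_adj], ?_⟩
      rw [subc, if_neg]
      simp only [Sym2.eq_iff]; grind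

theorem ev_lemma {H : SimpleGraph V} {c : Sym2 V → Sym2 V} (h : R H c) :
    ∀ p q y t, H.Adj p q → ¬ Iso H y → ¬ Co H c y (c s(p, q)) → Iso H t →
    Rr (addE (sub H p q t) t y) := by
  induction h with
  | base H c h hc =>
    intro p q y t hpq hy hco ht
    refine Rr.base (bc_ev h hpq hy ?_ ?_ ht)
    · rintro rfl; exact hco ⟨_, hpq, rfl⟩
    · rintro rfl; exact hco ⟨_, hpq.symm, by rw [Sym2.eq_swap]⟩
  | sub H c r s u h hrs hu ih =>
    have hur : u ≠ r := by rintro rfl; exact hu _ hrs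
    have hus : u ≠ s := by rintro rfl; exact hu _ hrs.symm
    intro p q y t hpq hy hco ht
    have ht' := (iso_sub_iff hrs hu).1 ht
    have htr : t ≠ r := by rintro rfl; exact ht'.1 _ hrs
    have hts : t ≠ s := by rintro rfl; exact ht'.1 _ hrs.symm
    have hrs' := hrs.ne
    by_cases hyu : y = u
    · subst hyu
      rw [co_sub_t hrs hu] at hco
      have hyp : p ≠ y ∧ q ≠ y := by
        by_contra hcon
        apply hco
        rw [subc, if_pos]
        have := hu p
        have := hu q
        have := H.adj_comm p q
        simp only [Sym2.eq_iff]
        rw [sub_adj] at hpq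
        grind
      have hpq1 : H.Adj p q ∧ ¬ ((p = r ∧ q = s) ∨ (p = s ∧ q = r)) := by
        rw [sub_adj] at hpq
        grind
      have hcol : subc c r s y s(p, q) = c s(p, q) := by
        rw [subc, if_neg]; simp only [Sym2.eq_iff]; grind
      rw [hcol] at hco
      have h1 := ee_lemma h p q r s t y hpq1.1 hrs (fun h => hco h) ht'.2 ht'.1 hu
      convert h1 using 1
      have htp : t ≠ p := by rintro rfl; exact ht'.1 _ hpq1.1
      have htq : t ≠ q := by rintro rfl; exact ht'.1 _ hpq1.1.symm
      have hpqn := hpq.ne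
      ext a b
      have := H.adj_comm a b
      have := ht'.1 a
      have := ht'.1 b
      have := hu a
      have := hu b
      simp only [addE_adj, sub_adj]
      clear h1 ih ht hpq hco hy hcol h hu
      grind (splits := 40)
    · have hy1 : ¬ Iso H y := by
        rw [iso_sub_iff hrs hu] at hy; tauto
      have hty : t ≠ y := by rintro rfl; exact hy ht
      rw [co_sub hrs hu hyu] at hco
      by_cases hat : p = u ∨ q = u
      · have hcol : subc c r s u s(p, q) = c s(r, s) := by
          rw [subc, if_pos]
          have := hu p
          have := hu q
          have := H.adj_comm p q
          simp only [Sym2.eq_iff]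
          rw [sub_adj] at hpq
          grind
        rw [hcol] at hco
        have key0 : ∀ r s, H.Adj r s → u ≠ r → u ≠ s → t ≠ r → t ≠ s → ¬ Co H c y (c s(r, s)) →
            Rr (addE (BGProof.sub (BGProof.sub H r s u) u r t) t y) := by
          intro r s hrs hur hus htr hts hco
          have h1 := ih r s y t hrs hy1 hco ht'.1
          have hys : y ≠ s := by
            rintro rfl; exact hco ⟨_, hrs.symm, by rw [Sym2.eq_swap]⟩
          have hyr : y ≠ r := by
            rintro rfl; exact hco ⟨_, hrs, rfl⟩
          have h2 : Rr (BGProof.sub _ s t u) := h1.sub (p := s) (q := t) (t := u)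
            (by simp only [addE_adj, sub_adj]; grind)
            (by intro z; have := hu z; simp only [addE_adj, sub_adj]; grind)
          convert h2 using 1
          have := hrs.ne
          ext a b
          have := H.adj_comm a b
          have := ht'.1 a
          have := ht'.1 b
          have := hu a
          have := hu b
          have := ht'.2
          simp only [addE_adj, sub_adj]
          clear h2 h1 ih ht hpq hco hy hcol h hu hat ht'
          grind (splits := 40)
        have hcases : (p = u ∧ q = r) ∨ (p = u ∧ q = s) ∨ (p = r ∧ q = u) ∨ (p = s ∧ q = u) := by
          have := hu p; have := hu q; have := H.adj_comm p q
          rw [sub_adj] at hpq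
          grind
        rcases hcases with ⟨rfl, rfl⟩ | ⟨rfl, rfl⟩ | ⟨rfl, rfl⟩ | ⟨rfl, rfl⟩
        · exact key0 _ _ hrs hur hus htr hts hco
        · rw [sub_comm' H]
          exact key0 _ _ hrs.symm hus hur hts htr (by rwa [Sym2.eq_swap])
        · rw [sub_comm' (BGProof.sub H _ _ _)]
          exact key0 _ _ hrs hur hus htr hts hco
        · rw [sub_comm' (BGProof.sub H _ _ _), sub_comm' H]
          exact key0 _ _ hrs.symm hus hur hts htr (by rwa [Sym2.eq_swap])
      · push Not at hat
        have hpq1 : H.Adj p q ∧ ¬ ((p = r ∧ q = s) ∨ (p = s ∧ q = r)) := by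
          rw [sub_adj] at hpq
          grind
        have hcol : subc c r s u s(p, q) = c s(p, q) := by
          rw [subc, if_neg]; simp only [Sym2.eq_iff]; grind
        rw [hcol] at hco
        have h1 := ih p q y t hpq1.1 hy1 hco ht'.1
        have h2 : Rr (BGProof.sub _ r s u) := h1.sub (p := r) (q := s) (t := u)
          (by simp only [addE_adj, sub_adj]; grind)
          (by intro z; have := hu z; simp only [addE_adj, sub_adj]; grind)
        convert h2 using 1
        have htp : t ≠ p := by rintro rfl; exact ht'.1 _ hpq1.1
        have htq : t ≠ q := by rintro rfl; exact ht'.1 _ hpq1.1.symm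
        have hpqn := hpq.ne
        have := hpq1.2
        have := ht'.2
        ext a b
        have := H.adj_comm a b
        have := ht'.1 a
        have := ht'.1 b
        have := hu a
        have := hu b
        simp only [addE_adj, sub_adj]
        clear h2 h1 ih ht hpq hco hy hcol h hu ht' hpq1
        grind (splits := 40)

theorem vv_lemma {H : SimpleGraph V} {c : Sym2 V → Sym2 V} (h : R H c) :
    ∀ x y, x ≠ y → ¬ Iso H x → ¬ Iso H y → (∀ γ, Co H c x γ → ¬ Co H c y γ) →
    Rr (addE H x y) := by
  induction h with
  | base H c h hc =>
    intro x y hxy hx hy hco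
    refine Rr.base (bc_vv h hx hy hxy ?_)
    intro hadj
    exact hco _ ⟨_, hadj, rfl⟩ ⟨_, hadj.symm, by rw [Sym2.eq_swap]⟩
  | sub H c p q t h hpq ht ih =>
    have key : ∀ y, t ≠ y → ¬ Iso (sub H p q t) y →
      (∀ γ, Co (sub H p q t) (subc c p q t) t γ → ¬ Co (sub H p q t) (subc c p q t) y γ) →
      Rr (addE (sub H p q t) t y) := by
      intro y hty hy hco
      refine ev_lemma h p q y t hpq ?_ ?_ ht
      · rw [iso_sub_iff hpq ht] at hy
        have := hty.symm
        tauto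
      · have := hco _ ((co_sub_t hpq ht _).2 rfl)
        rwa [co_sub hpq ht hty.symm] at this
    intro x y hxy hx hy hco
    by_cases hxt : x = t
    · subst hxt
      exact key y hxy hy hco
    by_cases hyt : y = t
    · subst hyt
      rw [addE_comm']
      exact key x hxy.symm hx (fun γ h1 h2 => hco γ h2 h1)
    have hco' : ∀ γ, Co H c x γ → ¬ Co H c y γ := by
      intro γ
      rw [← co_sub hpq ht hxt, ← co_sub hpq ht hyt]
      exact hco γ
    rw [iso_sub_iff hpq ht] at hx hy
    have h1 := ih x y hxy (by tauto) (by tauto) hco'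
    have htx : ¬ Iso H x := by tauto
    have hty : ¬ Iso H y := by tauto
    have h2 : Rr (BGProof.sub _ p q t) := h1.sub (p := p) (q := q) (t := t)
      (by simp only [addE_adj]; exact Or.inl hpq)
      (by intro z; have := ht z; simp only [addE_adj]; grind)
    convert h2 using 1
    have hxyp : ¬ ((x = p ∧ y = q) ∨ (x = q ∧ y = p)) := by
      rintro (⟨rfl, rfl⟩ | ⟨rfl, rfl⟩)
      · exact hco' _ ⟨_, hpq, rfl⟩ ⟨_, hpq.symm, by rw [Sym2.eq_swap]⟩
      · exact hco' _ ⟨_, hpq.symm, rfl⟩ ⟨_, hpq, by rw [Sym2.eq_swap]⟩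
    ext a b
    have := H.adj_comm a b
    simp only [addE_adj, sub_adj]
    clear h2 h1 ih hco hco' h
    grind (splits := 40)

end Ev


section Link

variable {V : Type u}

theorem deg_two {H : SimpleGraph V} (h : Bc H) {a b : V} (hab : H.Adj a b) :
    ∃ b', b' ≠ b ∧ H.Adj a b' := by
  have h1 := noCut_of_constructible (h {z // ¬ Iso H z} (H.comap Subtype.val)
    (Function.Embedding.subtype _) (by intro z; simp) (fun _ _ => Iff.rfl))
  obtain ⟨h4, hn⟩ := h1
  dsimp only at h4 hn
  let a' : {z // ¬ Iso H z} := ⟨a, not_iso.2 ⟨_, hab⟩⟩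
  let b' : {z // ¬ Iso H z} := ⟨b, not_iso.2 ⟨_, hab.symm⟩⟩
  have hne : a' ≠ b' := by
    intro h'; exact hab.ne (congrArg Subtype.val h')
  have hex : ∃ z, z ∉ ({a', b'} : Set _) := by
    by_contra! hcon
    have h2 : ({a', b'} : Set _) = Set.univ := Set.eq_univ_of_forall hcon
    have h3 : ({a', b'} : Set _).ncard ≤ 2 := (ncard_insert_le' _ _).trans (by simp)
    rw [h2, Set.ncard_univ] at h3
    omega
  obtain ⟨z, hz⟩ := hex
  simp only [Set.mem_insert_iff, Set.mem_singleton_iff, not_or] at hz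
  obtain ⟨x, y, hx, -, -, hy, hadj⟩ := hn {a'} {b'} (by simp) ⟨a', rfl, by simpa using hne⟩
    ⟨z, by simpa using hz.1, by simpa using hz.2⟩
  have hx' : x = a' := hx
  subst hx'
  refine ⟨y.1, ?_, hadj⟩
  intro h'
  exact hy (Subtype.ext h')

theorem link_inv {H : SimpleGraph V} {c : Sym2 V → Sym2 V} (h : R H c) :
    ∀ γ, (∃ z, Co H c z γ) → ∃ p q, (∃ γ', γ' ≠ γ ∧ Co H c p γ') ∧ (∃ γ', γ' ≠ γ ∧ Co H c q γ') ∧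
      (∀ z, z ≠ p → z ≠ q → Co H c z γ → ∀ γ', Co H c z γ' → γ' = γ) ∧
      ∃ s, s ≠ p ∧ s ≠ q ∧ ¬ Iso H s ∧ ¬ Co H c s γ := by
  induction h with
  | base H c h hc =>
    rintro γ ⟨a, b, hab, rfl⟩
    have hz : ∀ z, z ≠ a → z ≠ b → ¬ Co H c z (c s(a, b)) := by
      rintro z hza hzb ⟨w, hw, hcw⟩
      have := hc _ _ _ _ hw hab hcw
      rw [Sym2.eq_iff] at this
      tauto
    have hn : ∀ a b, H.Adj a b → ∃ γ', γ' ≠ c s(a, b) ∧ Co H c a γ' := by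
      intro a b hab
      obtain ⟨b', hb', hab'⟩ := deg_two h hab
      refine ⟨_, ?_, ⟨b', hab', rfl⟩⟩
      intro h'
      have := hc _ _ _ _ hab' hab h'
      rw [Sym2.eq_iff] at this
      have := hab.ne
      tauto
    refine ⟨a, b, hn a b hab, ?_, ?_, ?_⟩
    · have := hn b a hab.symm
      rwa [Sym2.eq_swap] at this
    · intro z hza hzb hco
      exact absurd hco (hz z hza hzb)
    · obtain ⟨b', hb', hab'⟩ := deg_two h hab
      exact ⟨b', hab'.ne.symm, hb', not_iso.2 ⟨a, hab'.symm⟩, hz _ hab'.ne.symm hb'⟩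
  | sub H c p0 q0 t h hpq ht ih =>
    rintro γ ⟨z, hz⟩
    have hnt : ∀ z γ, Co H c z γ → z ≠ t := by
      rintro z γ ⟨w, hw, -⟩ rfl
      exact ht _ hw
    have hex : ∃ z, Co H c z γ := by
      by_cases hzt : z = t
      · subst hzt
        rw [co_sub_t hpq ht] at hz
        exact ⟨p0, q0, hpq, hz.symm⟩
      · rw [co_sub hpq ht hzt] at hz
        exact ⟨z, hz⟩
    obtain ⟨p, q, ⟨γ1, h1, h1'⟩, ⟨γ2, h2, h2'⟩, h3, s, hsp, hsq, h4, h5⟩ := ih γ hex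
    have hst : s ≠ t := by rintro rfl; exact h4 ht
    refine ⟨p, q, ⟨γ1, h1, ?_⟩, ⟨γ2, h2, ?_⟩, ?_, s, hsp, hsq, ?_, ?_⟩
    · rwa [co_sub hpq ht (hnt _ _ h1')]
    · rwa [co_sub hpq ht (hnt _ _ h2')]
    · intro z hzp hzq hzγ γ' hγ'
      by_cases hzt : z = t
      · subst hzt
        rw [co_sub_t hpq ht] at hzγ hγ'
        rw [hzγ, hγ']
      · rw [co_sub hpq ht hzt] at hzγ hγ'
        exact h3 z hzp hzq hzγ γ' hγ'
    · rw [iso_sub_iff hpq ht]; tauto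
    · rwa [co_sub hpq ht hst]

end Link


section Paths

variable {V : Type u}

theorem exit_path {G : SimpleGraph V} (hG : KConnected 3 G) (S X Y : Set V) (hS : S.ncard ≤ 2)
    (hX : ∃ x, x ∈ X ∧ x ∉ S) (hY : ∃ y, y ∈ Y ∧ y ∉ S) :
    ∃ x y, ∃ P : G.Walk x y, P.IsPath ∧ x ∈ X ∧ y ∈ Y ∧ (∀ z ∈ P.support, z ∉ S) ∧
      ∀ z ∈ P.support, z = x ∨ z = y ∨ (z ∉ X ∧ z ∉ Y) := by
  classical
  have hex : ∃ n, ∃ x y, ∃ P : G.Walk x y, P.length = n ∧ x ∈ X ∧ y ∈ Y ∧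
      (∀ z ∈ P.support, z ∉ S) := by
    obtain ⟨x, hx, hxS⟩ := hX
    obtain ⟨y, hy, hyS⟩ := hY
    obtain ⟨w⟩ := (hG.2 S (by omega)).preconnected ⟨x, hxS⟩ ⟨y, hyS⟩
    refine ⟨_, x, y, w.map (SimpleGraph.Embedding.induce Sᶜ).toHom, rfl, hx, hy, ?_⟩
    intro z hz
    have hz2 := hz
    erw [SimpleGraph.Walk.support_map, List.mem_map] at hz2
    obtain ⟨z', -, rfl⟩ := hz2
    exact z'.2
  obtain ⟨x, y, P, hPn, hx, hy, hPS⟩ := Nat.find_spec hex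
  have hmin : ∀ x y, ∀ Q : G.Walk x y, x ∈ X → y ∈ Y → (∀ z ∈ Q.support, z ∉ S) →
      P.length ≤ Q.length := by
    intro x y Q hx hy hQ
    rw [hPn]
    exact Nat.find_min' hex ⟨x, y, Q, rfl, hx, hy, hQ⟩
  have hle := P.length_bypass_le_length
  refine ⟨x, y, P.bypass, P.bypass_isPath, hx, hy,
    fun z hz => hPS z (P.support_bypass_subset_support hz), ?_⟩
  intro z hz
  by_contra! hcon
  obtain ⟨h1, h2, h3⟩ := hcon
  have hsum : (P.bypass.takeUntil z hz).length + (P.bypass.dropUntil z hz).length =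
      P.bypass.length := by
    rw [← SimpleGraph.Walk.length_append, SimpleGraph.Walk.take_spec]
  by_cases hzX : z ∈ X
  · have := hmin z y (P.bypass.dropUntil z hz) hzX hy (fun u hu =>
      hPS u (P.support_bypass_subset_support (SimpleGraph.Walk.support_dropUntil_subset_support _ hz hu)))
    have h0 : (P.bypass.takeUntil z hz).length = 0 := by omega
    exact h1 (SimpleGraph.Walk.eq_of_length_eq_zero h0).symm
  · have hzY := h3 hzX
    have := hmin x z (P.bypass.takeUntil z hz) hx hzY (fun u hu =>
      hPS u (P.support_bypass_subset_support (SimpleGraph.Walk.support_takeUntil_subset_support _ hz hu)))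
    have h0 : (P.bypass.dropUntil z hz).length = 0 := by omega
    exact h2 (SimpleGraph.Walk.eq_of_length_eq_zero h0)

theorem path_lemma {G : SimpleGraph V} {x y : V} (P : G.Walk x y) :
    ∀ H : SimpleGraph V, P.IsPath → Rr H → H.Adj x y →
      (∀ z ∈ P.support, z = x ∨ z = y ∨ Iso H z) →
      ∃ H', Rr H' ∧ ∀ u v, H'.Adj u v ↔ (H.Adj u v ∧ s(u, v) ≠ s(x, y)) ∨ s(u, v) ∈ P.edges := by
  induction P with
  | nil => intro H _ _ h; exact absurd h (H.irrefl)
  | @cons x z y hxz P ih =>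
    intro H hP hR hadj hsup
    rw [SimpleGraph.Walk.cons_isPath_iff] at hP
    by_cases hzy : z = y
    · subst hzy
      obtain rfl : P = SimpleGraph.Walk.nil := SimpleGraph.Walk.isPath_iff_nil.1 hP.1 |>.eq_nil
      refine ⟨H, hR, ?_⟩
      intro u v
      simp only [SimpleGraph.Walk.edges_cons, SimpleGraph.Walk.edges_nil, List.mem_singleton]
      have : s(u, v) = s(x, z) → H.Adj u v := by
        intro h
        rw [Sym2.eq_iff] at h
        rcases h with ⟨rfl, rfl⟩ | ⟨rfl, rfl⟩
        · exact hadj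
        · exact hadj.symm
      tauto
    · have hzx : z ≠ x := hxz.ne.symm
      have hz : Iso H z := by
        have := hsup z (by simp)
        tauto
      have hxy := hadj.ne
      obtain ⟨H', hR', hH'⟩ := ih (BGProof.sub H x y z) hP.1 (hR.sub hadj hz)
        (by simp only [sub_adj]; tauto) (by
          intro w hw
          have h1 := hsup w (by simp [hw])
          rw [iso_sub_iff hadj hz]
          have : w ≠ x := by rintro rfl; exact hP.2 hw
          tauto)
      refine ⟨H', hR', ?_⟩
      intro u v
      rw [hH', SimpleGraph.Walk.edges_cons, List.mem_cons, sub_adj]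
      simp only [ne_eq, Sym2.eq_iff]
      have := hz u
      have := hz v
      have := H.adj_comm u v
      grind

end Paths


section Main

variable {V : Type u}

theorem Rr.exists_noniso {H : SimpleGraph V} (h : Rr H) : ∃ z, ¬ Iso H z := by
  obtain ⟨c, h⟩ := h
  induction h with
  | base H c h hc =>
    have h1 := noCut_of_constructible (h {z // ¬ Iso H z} (H.comap Subtype.val)
      (Function.Embedding.subtype _) (by intro z; simp) (fun _ _ => Iff.rfl))
    have h2 : 0 < Nat.card {z // ¬ Iso H z} := lt_of_lt_of_le (by norm_num) h1.1
    obtain ⟨⟨z⟩, -⟩ := Nat.card_pos_iff.1 h2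
    exact ⟨z.1, z.2⟩
  | sub H c p q t h hpq ht ih =>
    exact ⟨t, fun h => ((iso_sub_iff hpq ht).1 h).2 rfl⟩

theorem exists_mem_edges {G : SimpleGraph V} {x y : V} (P : G.Walk x y) (hxy : x ≠ y) {z : V}
    (hz : z ∈ P.support) : ∃ w, s(z, w) ∈ P.edges := by
  have hnil : ¬ P.Nil := by
    intro h; exact hxy h.eq
  rw [SimpleGraph.Walk.mem_support_iff_exists_mem_edges_of_not_nil hnil] at hz
  obtain ⟨e, he, hze⟩ := hz
  obtain ⟨w, rfl⟩ := hze
  exact ⟨w, he⟩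

/-- The measure used for the maximality argument. -/
noncomputable def meas (H : SimpleGraph V) : ℕ :=
  {z | ¬ Iso H z}.ncard * (Nat.card (Sym2 V) + 1) + H.edgeSet.ncard

theorem meas_lt [Finite V] {H H' : SimpleGraph V}
    (h : {z | ¬ Iso H z}.ncard < {z | ¬ Iso H' z}.ncard ∨
      ({z | ¬ Iso H z}.ncard ≤ {z | ¬ Iso H' z}.ncard ∧ H.edgeSet.ncard < H'.edgeSet.ncard)) :
    meas H < meas H' := by
  have h1 : H.edgeSet.ncard ≤ Nat.card (Sym2 V) := Set.ncard_le_card _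
  unfold meas
  rcases h with h | ⟨h, h2⟩
  · have : ({z | ¬ Iso H z}.ncard + 1) * (Nat.card (Sym2 V) + 1) ≤
        {z | ¬ Iso H' z}.ncard * (Nat.card (Sym2 V) + 1) := Nat.mul_le_mul_right _ h
    rw [Nat.add_mul] at this
    omega
  · have := Nat.mul_le_mul_right (Nat.card (Sym2 V) + 1) h
    omega

theorem aug [Finite V] {G H : SimpleGraph V} (hHG : H ≤ G) {x y : V} (hxy : x ≠ y)
    (hx : ¬ Iso H x) (hy : ¬ Iso H y) (P : G.Walk x y) (hP : P.IsPath)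
    (hinterior : ∀ z ∈ P.support, z = x ∨ z = y ∨ Iso H z) (hR : Rr (addE H x y))
    (hlen : H.Adj x y → ∃ z ∈ P.support, z ≠ x ∧ z ≠ y) :
    ∃ H', H' ≤ G ∧ Rr H' ∧ meas H < meas H' := by
  have hadd : ∀ u v, (addE H x y).Adj u v ∧ s(u, v) ≠ s(x, y) ↔ H.Adj u v ∧ s(u, v) ≠ s(x, y) := by
    intro u v
    simp only [addE_adj, ne_eq, Sym2.eq_iff]
    tauto
  obtain ⟨H', hR', hH'⟩ := path_lemma P (addE H x y) hP hR (by rw [addE_adj]; tauto) (by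
    intro z hz
    by_cases h1 : z = x
    · exact Or.inl h1
    by_cases h2 : z = y
    · exact Or.inr (Or.inl h2)
    have h3 : Iso H z := by have := hinterior z hz; tauto
    refine Or.inr (Or.inr fun u hu => ?_)
    have := h3 u
    rw [addE_adj] at hu
    tauto)
  have hadj : ∀ u v, H'.Adj u v ↔ (H.Adj u v ∧ s(u, v) ≠ s(x, y)) ∨ s(u, v) ∈ P.edges := by
    intro u v; rw [hH', hadd]
  have hsup : ∀ z ∈ P.support, ¬ Iso H' z := by
    intro z hz
    obtain ⟨w, hw⟩ := exists_mem_edges P hxy hz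
    exact not_iso.2 ⟨w, (hadj _ _).2 (Or.inr hw)⟩
  have hsub : {z | ¬ Iso H z} ⊆ {z | ¬ Iso H' z} := by
    intro z hz
    obtain ⟨w, hw⟩ := not_iso.1 hz
    by_cases h1 : s(z, w) = s(x, y)
    · have h2 : z = x ∨ z = y := by
        rw [Sym2.eq_iff] at h1; tauto
      apply hsup
      rcases h2 with rfl | rfl
      · exact P.start_mem_support
      · exact P.end_mem_support
    · exact not_iso.2 ⟨w, (hadj _ _).2 (Or.inl ⟨hw, h1⟩)⟩
  refine ⟨H', ?_, hR', meas_lt ?_⟩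
  · intro u v huv
    rcases (hadj u v).1 huv with h | h
    · exact hHG h.1
    · exact P.adj_of_mem_edges h
  by_cases hz : ∃ z ∈ P.support, z ≠ x ∧ z ≠ y
  · obtain ⟨z, hz, hzx, hzy⟩ := hz
    left
    apply Set.ncard_lt_ncard _ (Set.toFinite _)
    refine ⟨hsub, fun h => h (hsup z hz) ?_⟩
    have := hinterior z hz
    tauto
  · right
    have hnadj : ¬ H.Adj x y := fun h => hz (hlen h)
    refine ⟨Set.ncard_le_ncard hsub (Set.toFinite _), ?_⟩
    apply Set.ncard_lt_ncard _ (Set.toFinite _)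
    have hle : H ≤ H' := by
      intro u v huv
      refine (hadj u v).2 (Or.inl ⟨huv, ?_⟩)
      intro h
      rw [Sym2.eq_iff] at h
      rcases h with ⟨rfl, rfl⟩ | ⟨rfl, rfl⟩
      · exact hnadj huv
      · exact hnadj huv.symm
    refine ⟨SimpleGraph.edgeSet_mono hle, fun h => hnadj ?_⟩
    obtain ⟨w, hw⟩ := exists_mem_edges P hxy P.start_mem_support
    have hw1 : w ∈ P.support := P.snd_mem_support_of_mem_edges hw
    have hwx : w ≠ x := (P.adj_of_mem_edges hw).ne.symm
    have hwy : w = y := by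
      by_contra hwy
      exact hz ⟨w, hw1, hwx, hwy⟩
    subst hwy
    have : s(x, w) ∈ H'.edgeSet := (hadj _ _).2 (Or.inr hw)
    exact h this

theorem addE_of_adj {H : SimpleGraph V} {x y : V} (h : H.Adj x y) : addE H x y = H := by
  ext u v
  have := h.symm
  rw [addE_adj]
  grind

theorem bgc_of_seed [Finite V] {G : SimpleGraph V} (hG : KConnected 3 G)
    (hseed : ∃ H, H ≤ G ∧ Rr H) : BGConstructible ⟨V, G⟩ := by
  obtain ⟨H, ⟨hHG, hR⟩, hmax⟩ := Set.exists_max_image {H : SimpleGraph V | H ≤ G ∧ Rr H} meas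
    (Set.toFinite _) hseed
  have haug : ∀ H', H' ≤ G → Rr H' → ¬ meas H < meas H' := by
    intro H' h1 h2
    have := hmax H' ⟨h1, h2⟩
    omega
  clear hmax
  have hR0 := hR
  obtain ⟨c, hR⟩ := hR
  cases hR with
  | base _ _ hB hc =>
    have hvv : ∀ x y, x ≠ y → ¬ Iso H x → ¬ Iso H y → Rr (addE H x y) := by
      intro x y hxy hx hy
      by_cases hadj : H.Adj x y
      · rw [addE_of_adj hadj]; exact hR0
      · exact Rr.base (bc_vv hB hx hy hxy hadj)
    have hall : ∀ z, ¬ Iso H z := by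
      by_contra! hcon
      obtain ⟨o, ho⟩ := hcon
      obtain ⟨x0, hx0⟩ := hR0.exists_noniso
      obtain ⟨x, o', hx, -, ho', -, hadj⟩ := ((kconn_iff G).1 hG).2 {z | ¬ Iso H z} ∅ (by simp)
        ⟨x0, hx0, by simp⟩ ⟨o, by simpa using ho, by simp⟩
      simp only [Set.mem_ofPred_eq, not_not] at hx ho'
      obtain ⟨x1, hx1⟩ := not_iso.1 hx
      obtain ⟨o2, y, P, hP, ho2, hy, hPS, hPi⟩ := exit_path hG {x} {o'} {z | ¬ Iso H z} (by simp)
        ⟨o', rfl, by simpa using hadj.ne.symm⟩ ⟨x1, not_iso.2 ⟨x, hx1.symm⟩, by simpa using hx1.ne.symm⟩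
      obtain rfl : o2 = o' := ho2
      have hxP : x ∉ P.support := fun h => hPS x h rfl
      have hxy : x ≠ y := by
        rintro rfl; exact hxP P.end_mem_support
      have hy' : ¬ Iso H y := hy
      obtain ⟨H', h1, h2, h3⟩ := aug hHG hxy hx hy' (SimpleGraph.Walk.cons hadj P)
        (by rw [SimpleGraph.Walk.cons_isPath_iff]; exact ⟨hP, hxP⟩)
        (by
          intro z hz
          rw [SimpleGraph.Walk.support_cons, List.mem_cons] at hz
          rcases hz with hz | hz
          · exact Or.inl hz
          · rcases hPi z hz with h | h | h
            · subst h; exact Or.inr (Or.inr ho')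
            · exact Or.inr (Or.inl h)
            · have := h.2
              simp only [Set.mem_ofPred_eq, not_not] at this
              exact Or.inr (Or.inr this))
        (hvv x y hxy hx hy')
        (fun _ => ⟨o2, by simp, hadj.ne.symm, by rintro rfl; exact hy' ho'⟩)
      exact haug H' h1 h2 h3
    have hEq : ∀ x y, G.Adj x y → H.Adj x y := by
      intro x y hxy
      by_contra hn
      obtain ⟨H', h1, h2, h3⟩ := aug hHG hxy.ne (hall x) (hall y)
        (SimpleGraph.Walk.cons hxy SimpleGraph.Walk.nil)
        (by simp [hxy.ne])
        (by intro z hz; simp at hz; tauto)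
        (hvv x y hxy.ne (hall x) (hall y)) (fun h => absurd h hn)
      exact haug H' h1 h2 h3
    exact hB V G (Function.Embedding.refl V) (by intro z; simpa using hall z)
      (fun x y => ⟨hEq x y, fun h => hHG h⟩)
  | sub H1 c p0 q0 t h hpq ht =>
    exfalso
    have hR1 := R.sub H1 c p0 q0 t h hpq ht
    have hCt := fun γ => co_sub_t (c := c) hpq ht γ
    generalize subc c p0 q0 t = c' at *
    generalize BGProof.sub H1 p0 q0 t = H at *
    obtain ⟨p, q, ⟨γ1, hγ1, hp⟩, ⟨γ2, hγ2, hq⟩, hX, s, hsp, hsq, hs, hsγ⟩ :=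
      link_inv hR1 (c s(p0, q0)) ⟨t, (hCt _).2 rfl⟩
    have htp : t ≠ p := by
      rintro rfl; exact hγ1 ((hCt _).1 hp)
    have htq : t ≠ q := by
      rintro rfl; exact hγ2 ((hCt _).1 hq)
    generalize c s(p0, q0) = γ at *
    obtain ⟨x, y, P, hP, hx, hy, hPS, hPi⟩ := exit_path hG {p, q}
      {z | z ≠ p ∧ z ≠ q ∧ Co H c' z γ} {z | ¬ Iso H z ∧ ¬ Co H c' z γ}
      ((ncard_insert_le' _ _).trans (by simp)) ⟨t, ⟨htp, htq, (hCt _).2 rfl⟩, by simp [htp, htq]⟩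
      ⟨s, ⟨hs, hsγ⟩, by simp [hsp, hsq]⟩
    have hx' : x ≠ p ∧ x ≠ q ∧ Co H c' x γ := hx
    have hy' : ¬ Iso H y ∧ ¬ Co H c' y γ := hy
    have hxy : x ≠ y := by
      rintro rfl; exact hy'.2 hx'.2.2
    have hxn : ¬ Iso H x := by
      obtain ⟨w, hw, -⟩ := hx'.2.2
      exact not_iso.2 ⟨w, hw⟩
    have hco : ∀ γ', Co H c' x γ' → ¬ Co H c' y γ' := by
      intro γ' h1 h2
      rw [hX x hx'.1 hx'.2.1 hx'.2.2 γ' h1] at h2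
      exact hy'.2 h2
    have hna : ¬ H.Adj x y := by
      intro hadj
      exact hco _ ⟨_, hadj, rfl⟩ ⟨_, hadj.symm, by rw [Sym2.eq_swap]⟩
    obtain ⟨H', h1, h2, h3⟩ := aug hHG hxy hxn hy'.1 P hP
      (by
        intro z hz
        have hzS := hPS z hz
        simp only [Set.mem_insert_iff, Set.mem_singleton_iff, not_or] at hzS
        rcases hPi z hz with h | h | ⟨h, h'⟩
        · exact Or.inl h
        · exact Or.inr (Or.inl h)
        · simp only [Set.mem_ofPred_eq] at h h'
          tauto)
      (vv_lemma hR1 x y hxy hxn hy'.1 hco) (fun h => absurd h hna)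
    exact haug H' h1 h2 h3

end Main


section Seed

variable {V : Type u}

theorem k4_rr (T : Set V) (hT : T.ncard = 4) (K : SimpleGraph V)
    (hK : ∀ u v, K.Adj u v ↔ u ≠ v ∧ u ∈ T ∧ v ∈ T) : Rr K := by
  apply Rr.base
  intro W L f hf hL
  have hiso : ∀ z, ¬ Iso K z ↔ z ∈ T := by
    intro z
    rw [not_iso]
    constructor
    · rintro ⟨u, hu⟩
      exact ((hK _ _).1 hu).2.1
    · intro hz
      obtain ⟨u, hu, huz⟩ := Set.exists_ne_of_one_lt_ncard (by omega : 1 < T.ncard) z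
      exact ⟨u, (hK _ _).2 ⟨huz.symm, hz, hu⟩⟩
  have hr : Set.range f = T := by
    ext z
    rw [← hiso, ← hf]
    rfl
  have hcard : Nat.card W = 4 := by
    rw [← hT, ← hr, ← Nat.card_coe_set_eq]
    exact Nat.card_congr (Equiv.ofInjective f f.injective)
  have hfin : Finite W := (Nat.card_pos_iff.1 (by omega)).2
  refine BGConstructible.base L ⟨⟨Finite.equivFinOfCardEq hcard, ?_⟩⟩
  intro a b
  rw [hL, hK, ← hr]
  simp [SimpleGraph.completeGraph]

/-- The invariant for replacing the pending edges `D` by paths. -/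
def State (G : SimpleGraph V) (D : Set (Sym2 V)) (T : Set V) : Prop :=
  ∃ H, Rr H ∧ (∀ u v, H.Adj u v → G.Adj u v ∨ s(u, v) ∈ D) ∧
    (∀ u v, s(u, v) ∈ D → H.Adj u v) ∧ ∀ z, z ∉ T → Iso H z

theorem State.step {G : SimpleGraph V} {D : Set (Sym2 V)} {T : Set V} {x y : V} (P : G.Walk x y)
    (h : State G (insert s(x, y) D) T) (hP : P.IsPath) (hD : s(x, y) ∉ D)
    (hT : ∀ z ∈ P.support, z = x ∨ z = y ∨ z ∉ T) : State G D (T ∪ {z | z ∈ P.support}) := by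
  obtain ⟨H, hR, h1, h2, h3⟩ := h
  obtain ⟨H', hR', hH'⟩ := path_lemma P H hP hR (h2 _ _ (by simp)) (by
    intro z hz
    rcases hT z hz with h | h | h
    · exact Or.inl h
    · exact Or.inr (Or.inl h)
    · exact Or.inr (Or.inr (h3 z h)))
  refine ⟨H', hR', ?_, ?_, ?_⟩
  · intro u v huv
    rcases (hH' u v).1 huv with ⟨h, hne⟩ | h
    · rcases h1 u v h with h | h
      · exact Or.inl h
      · exact Or.inr ((Set.mem_insert_iff.1 h).resolve_left hne)
    · exact Or.inl (P.adj_of_mem_edges h)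
  · intro u v huv
    refine (hH' u v).2 (Or.inl ⟨h2 u v (Set.mem_insert_of_mem _ huv), ?_⟩)
    intro h; rw [h] at huv; exact hD huv
  · intro z hz u hu
    simp only [Set.mem_union, Set.mem_ofPred_eq, not_or] at hz
    rcases (hH' z u).1 hu with ⟨h, -⟩ | h
    · exact h3 z hz.1 u h
    · exact hz.2 (P.fst_mem_support_of_mem_edges h)

theorem segment {G : SimpleGraph V} (f : ℕ → V) (n j : ℕ) (hj : j ≤ n)
    (hinj : ∀ a b, a ≤ n → b ≤ n → f a = f b → a = b) (hadj : ∀ a, a < n → G.Adj (f a) (f (a + 1))) :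
    ∀ d i, i + d = j → ∃ W : G.Walk (f i) (f j), W.IsPath ∧
      ∀ z ∈ W.support, ∃ m, i ≤ m ∧ m ≤ j ∧ z = f m := by
  intro d
  induction d with
  | zero =>
    intro i hi
    obtain rfl : i = j := by omega
    exact ⟨SimpleGraph.Walk.nil, by simp, by intro z hz; simp at hz; exact ⟨i, le_rfl, le_rfl, hz⟩⟩
  | succ d ih =>
    intro i hi
    obtain ⟨W, hW, hs⟩ := ih (i + 1) (by omega)
    refine ⟨SimpleGraph.Walk.cons (hadj i (by omega)) W, ?_, ?_⟩
    · rw [SimpleGraph.Walk.cons_isPath_iff]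
      refine ⟨hW, fun h => ?_⟩
      obtain ⟨m, h1, h2, h3⟩ := hs _ h
      have := hinj _ _ (by omega) (by omega) h3
      omega
    · intro z hz
      rw [SimpleGraph.Walk.support_cons, List.mem_cons] at hz
      rcases hz with rfl | hz
      · exact ⟨i, le_rfl, by omega, rfl⟩
      · obtain ⟨m, h1, h2, h3⟩ := hs _ hz
        exact ⟨m, by omega, h2, h3⟩

theorem exists_nbr {G : SimpleGraph V} (hG : KConnected 3 G) (v : V) (S : Set V) (hS : S.ncard ≤ 2)
    (hv : v ∉ S) : ∃ y, y ∉ S ∧ G.Adj v y := by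
  obtain ⟨h4, hn⟩ := (kconn_iff G).1 hG
  have hfin : Finite V := (Nat.card_pos_iff.1 (by omega)).2
  have hex : ∃ z, z ∉ insert v S := by
    by_contra! hcon
    have h2 : insert v S = Set.univ := Set.eq_univ_of_forall hcon
    have h3 := ncard_insert_le' S v
    rw [h2, Set.ncard_univ] at h3
    omega
  obtain ⟨z, hz⟩ := hex
  simp only [Set.mem_insert_iff, not_or] at hz
  obtain ⟨x, y, hx, -, -, hy, hadj⟩ := hn {v} S hS ⟨v, rfl, hv⟩ ⟨z, by simpa using hz.1, hz.2⟩
  obtain rfl : x = v := hx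
  exact ⟨y, hy, hadj⟩

theorem long_path [Finite V] {G : SimpleGraph V} (hG : KConnected 3 G) :
    ∃ (f : ℕ → V) (n i j : ℕ), (∀ a b, a ≤ n → b ≤ n → f a = f b → a = b) ∧
      (∀ a, a < n → G.Adj (f a) (f (a + 1))) ∧ 1 < i ∧ i < j ∧ j ≤ n ∧ G.Adj (f 0) (f i) ∧
      G.Adj (f 0) (f j) := by
  classical
  have := Fintype.ofFinite V
  have hne : Nonempty V := (Nat.card_pos_iff.1 (by have := hG.1; omega)).1
  let p : ℕ → Prop := fun n => ∃ u v, ∃ P : G.Walk u v, P.IsPath ∧ P.length = n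
  have hp0 : p 0 := ⟨hne.some, hne.some, SimpleGraph.Walk.nil, by simp, rfl⟩
  have hub : ∀ n, p n → n ≤ Fintype.card V := by
    rintro n ⟨u, v, P, hP, rfl⟩
    exact hP.length_lt.le
  obtain ⟨u, v, P, hP, hlen⟩ : p (Nat.findGreatest p (Fintype.card V)) :=
    Nat.findGreatest_spec (Nat.zero_le _) hp0
  have hmax : ∀ m, p m → m ≤ P.length := by
    intro m hm
    rw [hlen]
    exact Nat.le_findGreatest (hub m hm) hm
  have hnb : ∀ w, G.Adj u w → ∃ m, 1 ≤ m ∧ m ≤ P.length ∧ w = P.getVert m := by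
    intro w hw
    have hwP : w ∈ P.support := by
      by_contra hwP
      have := hmax (P.length + 1) ⟨w, v, SimpleGraph.Walk.cons hw.symm P, by
        rw [SimpleGraph.Walk.cons_isPath_iff]; exact ⟨hP, hwP⟩, by simp⟩
      omega
    obtain ⟨m, h1, h2⟩ := SimpleGraph.Walk.mem_support_iff_exists_getVert.1 hwP
    refine ⟨m, ?_, h2, h1.symm⟩
    by_contra hm
    obtain rfl : m = 0 := by omega
    rw [SimpleGraph.Walk.getVert_zero] at h1
    exact hw.ne h1
  have hu : u = P.getVert 0 := (SimpleGraph.Walk.getVert_zero P).symm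
  have hinj : ∀ a b, a ≤ P.length → b ≤ P.length → P.getVert a = P.getVert b → a = b :=
    fun a b ha hb h => hP.getVert_injOn ha hb h
  have hadj : ∀ a, a < P.length → G.Adj (P.getVert a) (P.getVert (a + 1)) :=
    fun a ha => P.adj_getVert_succ ha
  obtain ⟨w0, -, hw0⟩ := exists_nbr hG u ∅ (by simp) (by simp)
  obtain ⟨m0, hm0, hm0', -⟩ := hnb w0 hw0
  have hu1 : u ≠ P.getVert 1 := by
    intro h
    have := hinj 0 1 (by omega) (by omega) (hu.symm.trans h)
    omega
  obtain ⟨w1, hw1, hw1'⟩ := exists_nbr hG u {P.getVert 1} (by simp) (by simpa using hu1)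
  obtain ⟨i, hi, hi', rfl⟩ := hnb w1 hw1'
  obtain ⟨w2, hw2, hw2'⟩ := exists_nbr hG u {P.getVert 1, P.getVert i}
    ((ncard_insert_le' _ _).trans (by simp)) (by simp [hu1, hw1'.ne])
  obtain ⟨j, hj, hj', rfl⟩ := hnb w2 hw2'
  simp only [Set.mem_insert_iff, Set.mem_singleton_iff, not_or] at hw1 hw2
  have hi1 : i ≠ 1 := by rintro rfl; exact hw1 rfl
  have hj1 : j ≠ 1 := by rintro rfl; exact hw2.1 rfl
  have hij : i ≠ j := by rintro rfl; exact hw2.2 rfl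
  rcases lt_or_gt_of_ne hij with h | h
  · exact ⟨P.getVert, P.length, i, j, hinj, hadj, by omega, h, hj', by rwa [← hu], by rwa [← hu]⟩
  · exact ⟨P.getVert, P.length, j, i, hinj, hadj, by omega, h, hi', by rwa [← hu], by rwa [← hu]⟩

theorem k4_state {G : SimpleGraph V} {a b c d : V} (hab : a ≠ b) (hac : a ≠ c) (had : a ≠ d)
    (hbc : b ≠ c) (hbd : b ≠ d) (hcd : c ≠ d) (hG : G.Adj a b) :
    State G {s(c, d), s(a, c), s(c, b), s(b, d), s(a, d)} {a, b, c, d} := by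
  refine ⟨{ Adj := fun u v => u ≠ v ∧ u ∈ ({a, b, c, d} : Set V) ∧ v ∈ ({a, b, c, d} : Set V)
            symm := ⟨fun u v h => ⟨h.1.symm, h.2.2, h.2.1⟩⟩
            loopless := ⟨fun u h => h.1 rfl⟩ }, ?_, ?_, ?_, ?_⟩
  · refine k4_rr {a, b, c, d} ?_ _ (fun _ _ => Iff.rfl)
    rw [Set.ncard_insert_of_notMem (by simp [hab, hac, had]),
      Set.ncard_insert_of_notMem (by simp [hbc, hbd]), Set.ncard_pair hcd]
  · rintro u v ⟨h1, h2, h3⟩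
    have := hG.symm
    simp only [Set.mem_insert_iff, Set.mem_singleton_iff, Sym2.eq_iff] at *
    grind
  · intro u v h
    simp only [Set.mem_insert_iff, Set.mem_singleton_iff, Sym2.eq_iff] at *
    grind
  · rintro z hz u ⟨-, hu, -⟩
    exact hz hu

theorem seed [Finite V] {G : SimpleGraph V} (hG : KConnected 3 G) : ∃ H, H ≤ G ∧ Rr H := by
  obtain ⟨f, n, i, j, hinj, hadj, hi, hij, hjn, h0i, h0j⟩ := long_path hG
  have hne : ∀ a b, a ≤ n → b ≤ n → a ≠ b → f a ≠ f b := fun a b ha hb hab h =>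
    hab (hinj a b ha hb h)
  obtain ⟨x, y, Q, hQ, ⟨k, hk1, hk2, hxk⟩, ⟨l, hl1, hl2, hyl⟩, hQS, hQi⟩ :=
    exit_path hG {f 0, f i} {z | ∃ m, 1 ≤ m ∧ m < i ∧ z = f m} {z | ∃ m, i < m ∧ m ≤ j ∧ z = f m}
      ((ncard_insert_le' _ _).trans (by simp))
      ⟨f 1, ⟨1, le_rfl, hi, rfl⟩, by
        simp only [Set.mem_insert_iff, Set.mem_singleton_iff, not_or]
        exact ⟨hne _ _ (by omega) (by omega) (by omega), hne _ _ (by omega) (by omega) (by omega)⟩⟩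
      ⟨f j, ⟨j, hij, le_rfl, rfl⟩, by
        simp only [Set.mem_insert_iff, Set.mem_singleton_iff, not_or]
        exact ⟨hne _ _ (by omega) (by omega) (by omega), hne _ _ (by omega) (by omega) (by omega)⟩⟩
  subst hxk hyl
  have hQm : ∀ m, m ≤ j → f m ∈ Q.support → m = k ∨ m = l := by
    intro m hm hmQ
    have h1 := hQS _ hmQ
    simp only [Set.mem_insert_iff, Set.mem_singleton_iff, not_or] at h1
    rcases hQi _ hmQ with h | h | ⟨h2, h3⟩
    · exact Or.inl (hinj _ _ (by omega) (by omega) h)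
    · exact Or.inr (hinj _ _ (by omega) (by omega) h)
    · exfalso
      have hm0 : m ≠ 0 := by rintro rfl; exact h1.1 rfl
      have hmi : m ≠ i := by rintro rfl; exact h1.2 rfl
      by_cases hmi' : m < i
      · exact h2 ⟨m, by omega, hmi', rfl⟩
      · exact h3 ⟨m, by omega, hm, rfl⟩
  obtain ⟨P1, hP1, hs1⟩ := segment (G := G) f n k (by omega) hinj hadj k 0 (by omega)
  obtain ⟨P2, hP2, hs2⟩ := segment (G := G) f n i (by omega) hinj hadj (i - k) k (by omega)
  obtain ⟨P3, hP3, hs3⟩ := segment (G := G) f n l (by omega) hinj hadj (l - i) i (by omega)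
  obtain ⟨P4', hP4', hs4'⟩ := segment (G := G) f n j (by omega) hinj hadj (j - l) l (by omega)
  obtain ⟨P4, hP4, hs4⟩ : ∃ W : G.Walk (f 0) (f l), W.IsPath ∧
      ∀ z ∈ W.support, ∃ m, (m = 0 ∨ l ≤ m) ∧ m ≤ j ∧ z = f m := by
    refine ⟨SimpleGraph.Walk.cons h0j P4'.reverse, ?_, ?_⟩
    · rw [SimpleGraph.Walk.cons_isPath_iff]
      refine ⟨hP4'.reverse, fun h => ?_⟩
      rw [SimpleGraph.Walk.support_reverse, List.mem_reverse] at h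
      obtain ⟨m, h1, h2, h3⟩ := hs4' _ h
      have := hinj _ _ (by omega) (by omega) h3
      omega
    · intro z hz
      rw [SimpleGraph.Walk.support_cons, List.mem_cons, SimpleGraph.Walk.support_reverse,
        List.mem_reverse] at hz
      rcases hz with rfl | hz
      · exact ⟨0, Or.inl rfl, by omega, rfl⟩
      · obtain ⟨m, h1, h2, h3⟩ := hs4' _ hz
        exact ⟨m, Or.inr h1, h2, h3⟩
  have e0i := hne 0 i (by omega) (by omega) (by omega)
  have e0k := hne 0 k (by omega) (by omega) (by omega)
  have e0l := hne 0 l (by omega) (by omega) (by omega)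
  have eik := hne i k (by omega) (by omega) (by omega)
  have eil := hne i l (by omega) (by omega) (by omega)
  have ekl := hne k l (by omega) (by omega) (by omega)
  have st0 := k4_state e0i e0k e0l eik eil ekl h0i
  have hn : ∀ m m', m ≤ j → m' ≤ j → (f m = f m' ↔ m = m') := by
    intro m m' h h'
    exact ⟨hinj _ _ (by omega) (by omega), fun h => by rw [h]⟩
  have st1 := st0.step Q hQ (by simp only [Set.mem_insert_iff, Set.mem_singleton_iff, Sym2.eq_iff]; grind)
    (by
      intro z hz
      by_cases h : ∃ m, m ≤ j ∧ z = f m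
      · obtain ⟨m, hm, rfl⟩ := h
        rcases hQm m hm hz with rfl | rfl
        · exact Or.inl rfl
        · exact Or.inr (Or.inl rfl)
      · right; right
        simp only [Set.mem_insert_iff, Set.mem_singleton_iff]
        rintro (rfl | rfl | rfl | rfl)
        · exact h ⟨0, by omega, rfl⟩
        · exact h ⟨i, by omega, rfl⟩
        · exact h ⟨k, by omega, rfl⟩
        · exact h ⟨l, by omega, rfl⟩)
  have st2 := st1.step P1 hP1 (by simp only [Set.mem_insert_iff, Set.mem_singleton_iff, Sym2.eq_iff]; grind)
    (by
      intro z hz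
      obtain ⟨m, h1, h2, rfl⟩ := hs1 z hz
      rw [hn _ _ (by omega) (by omega), hn _ _ (by omega) (by omega)]
      by_cases hm0 : m = 0
      · exact Or.inl hm0
      by_cases hmk : m = k
      · exact Or.inr (Or.inl hmk)
      right; right
      rintro (h | h)
      · simp only [Set.mem_insert_iff, Set.mem_singleton_iff] at h
        rw [hn _ _ (by omega) (by omega), hn _ _ (by omega) (by omega),
          hn _ _ (by omega) (by omega), hn _ _ (by omega) (by omega)] at h
        omega
      · have := hQm m (by omega) h
        omega)
  have st3 := st2.step P2 hP2 (by simp only [Set.mem_insert_iff, Set.mem_singleton_iff, Sym2.eq_iff]; grind)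
    (by
      intro z hz
      obtain ⟨m, h1, h2, rfl⟩ := hs2 z hz
      rw [hn _ _ (by omega) (by omega), hn _ _ (by omega) (by omega)]
      by_cases hm0 : m = k
      · exact Or.inl hm0
      by_cases hmk : m = i
      · exact Or.inr (Or.inl hmk)
      right; right
      rintro ((h | h) | h)
      · simp only [Set.mem_insert_iff, Set.mem_singleton_iff] at h
        rw [hn _ _ (by omega) (by omega), hn _ _ (by omega) (by omega),
          hn _ _ (by omega) (by omega), hn _ _ (by omega) (by omega)] at h
        omega
      · have := hQm m (by omega) h
        omega
      · obtain ⟨m', h3, h4, h5⟩ := hs1 _ h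
        rw [hn _ _ (by omega) (by omega)] at h5
        omega)
  have st4 := st3.step P3 hP3 (by simp only [Set.mem_insert_iff, Set.mem_singleton_iff, Sym2.eq_iff]; grind)
    (by
      intro z hz
      obtain ⟨m, h1, h2, rfl⟩ := hs3 z hz
      rw [hn _ _ (by omega) (by omega), hn _ _ (by omega) (by omega)]
      by_cases hm0 : m = i
      · exact Or.inl hm0
      by_cases hmk : m = l
      · exact Or.inr (Or.inl hmk)
      right; right
      rintro (((h | h) | h) | h)
      · simp only [Set.mem_insert_iff, Set.mem_singleton_iff] at h
        rw [hn _ _ (by omega) (by omega), hn _ _ (by omega) (by omega),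
          hn _ _ (by omega) (by omega), hn _ _ (by omega) (by omega)] at h
        omega
      · have := hQm m (by omega) h
        omega
      · obtain ⟨m', h3, h4, h5⟩ := hs1 _ h
        rw [hn _ _ (by omega) (by omega)] at h5
        omega
      · obtain ⟨m', h3, h4, h5⟩ := hs2 _ h
        rw [hn _ _ (by omega) (by omega)] at h5
        omega)
  rw [← LawfulSingleton.insert_empty_eq] at st4
  have st5 := st4.step P4 hP4 (by simp)
    (by
      intro z hz
      obtain ⟨m, h1, h2, rfl⟩ := hs4 z hz
      rw [hn _ _ (by omega) (by omega), hn _ _ (by omega) (by omega)]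
      by_cases hm0 : m = 0
      · exact Or.inl hm0
      by_cases hmk : m = l
      · exact Or.inr (Or.inl hmk)
      right; right
      rintro ((((h | h) | h) | h) | h)
      · simp only [Set.mem_insert_iff, Set.mem_singleton_iff] at h
        rw [hn _ _ (by omega) (by omega), hn _ _ (by omega) (by omega),
          hn _ _ (by omega) (by omega), hn _ _ (by omega) (by omega)] at h
        omega
      · have := hQm m (by omega) h
        omega
      · obtain ⟨m', h3, h4, h5⟩ := hs1 _ h
        rw [hn _ _ (by omega) (by omega)] at h5
        omega
      · obtain ⟨m', h3, h4, h5⟩ := hs2 _ h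
        rw [hn _ _ (by omega) (by omega)] at h5
        omega
      · obtain ⟨m', h3, h4, h5⟩ := hs3 _ h
        rw [hn _ _ (by omega) (by omega)] at h5
        omega)
  obtain ⟨H, hR, h1, -, -⟩ := st5
  refine ⟨H, fun u v huv => ?_, hR⟩
  rcases h1 u v huv with h | h
  · exact h
  · exact absurd h (by simp)

end Seed


end BGProof

/-- A finite simple graph is 3-connected if and only if it can be
constructed from the complete graph `K₄` by a sequence of BG-operations. -/
theorem threeConnected_iff_bgConstructible {V : Type u} [Fintype V] (G : SimpleGraph V) :
    KConnected 3 G ↔ BGConstructible ⟨V, G⟩ := by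
  constructor
  · intro h
    exact BGProof.bgc_of_seed h (BGProof.seed h)
  · intro h
    exact (BGProof.kconn_iff G).2 (BGProof.noCut_of_constructible h)
end

section
/- If G is a finite simple 3-connected graph and G' is obtained from G by applying a single BG-operation, then G' is simple and 3-connected. -/
open SimpleGraph

universe u

variable {V : Type u}

/-- Cut formulation of: deleting fewer than 3 vertices leaves at most one component. -/
def CutGood {V : Type u} (G : SimpleGraph V) : Prop :=
  ∀ (S : Set V) (A : V → Prop), S.ncard < 3 →
    (∀ p q, p ∉ S → q ∉ S → G.Adj p q → (A p ↔ A q)) →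
    ∀ x y, x ∉ S → y ∉ S → (A x ↔ A y)

theorem cutGood_of_kConnected {V : Type u} (G : SimpleGraph V) (h : KConnected 3 G) :
    CutGood G := by
  intro S A hS hA x y hx hy
  have hc := (h.2 S hS).preconnected ⟨x, hx⟩ ⟨y, hy⟩
  obtain ⟨p⟩ := hc
  have key : ∀ (u v : (Sᶜ : Set V)) (_ : (G.induce Sᶜ).Walk u v), (A u.1 ↔ A v.1) := by
    intro u v p
    induction p with
    | nil => exact Iff.rfl
    | @cons u v w hadj _ ih =>
      exact (hA u.1 v.1 u.2 v.2 (by simpa using hadj)).trans ih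
  exact key _ _ p

theorem kConnected_of_cutGood {V : Type u} [Fintype V] (G : SimpleGraph V)
    (hcard : 4 ≤ Nat.card V) (h : CutGood G) : KConnected 3 G := by
  refine ⟨hcard, fun S hS => ?_⟩
  have hne : ∃ z, z ∉ S := by
    by_contra hcon
    push Not at hcon
    have : S = Set.univ := Set.eq_univ_of_forall hcon
    rw [this, Set.ncard_univ] at hS
    omega
  obtain ⟨z, hz⟩ := hne
  have : Nonempty (Sᶜ : Set V) := ⟨⟨z, hz⟩⟩
  refine ⟨fun u v => ?_⟩
  have := h S (fun w => ∃ hw : w ∈ Sᶜ, (G.induce Sᶜ).Reachable u ⟨w, hw⟩) hS ?_ u.1 v.1 u.2 v.2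
  · exact (this.1 ⟨u.2, Reachable.refl _⟩).2
  · intro p q hp hq hpq
    have hadj : (G.induce Sᶜ).Adj ⟨p, hp⟩ ⟨q, hq⟩ := by simpa using hpq
    exact ⟨fun ⟨_, hr⟩ => ⟨hq, hr.trans hadj.reachable⟩,
      fun ⟨_, hr⟩ => ⟨hp, hr.trans hadj.symm.reachable⟩⟩

theorem exists_not_mem_of_ncard {V : Type u} [Fintype V] (hcard : 4 ≤ Nat.card V) (S : Set V)
    (hS : S.ncard < 4) : ∃ z, z ∉ S := by
  by_contra hcon
  push Not at hcon
  have : S = Set.univ := Set.eq_univ_of_forall hcon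
  rw [this, Set.ncard_univ] at hS
  omega

/-- Deleting at most one vertex and one edge. -/
theorem cut_one {V : Type u} [Fintype V] (G : SimpleGraph V) (hcard : 4 ≤ Nat.card V)
    (h : CutGood G) (T : Set V) (A : V → Prop) (a b : V) (hT : T.ncard < 2)
    (hA : ∀ p q, p ∉ T → q ∉ T → G.Adj p q → s(p, q) ≠ s(a, b) → (A p ↔ A q)) :
    ∀ x y, x ∉ T → y ∉ T → (A x ↔ A y) := by
  have hTa : (insert a T).ncard < 3 := by have := Set.ncard_insert_le a T; omega
  have hTb : (insert b T).ncard < 3 := by have := Set.ncard_insert_le b T; omega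
  have hTab : (insert b (insert a T)).ncard < 4 := by
    have := Set.ncard_insert_le b (insert a T); omega
  by_cases hab : a ∉ T ∧ b ∉ T ∧ ¬ (A a ↔ A b)
  · exfalso
    obtain ⟨ha, hb, hn⟩ := hab
    have hne : a ≠ b := by rintro rfl; exact hn Iff.rfl
    obtain ⟨z, hz⟩ := exists_not_mem_of_ncard hcard _ hTab
    have h1 := h _ A hTa (by
      intro p q hp hq hpq
      simp only [Set.mem_insert_iff, not_or] at hp hq
      exact hA p q hp.2 hq.2 hpq (by simp; tauto)) z b (by simp at hz ⊢; tauto)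
        (by simp; tauto)
    have h2 := h _ A hTb (by
      intro p q hp hq hpq
      simp only [Set.mem_insert_iff, not_or] at hp hq
      exact hA p q hp.2 hq.2 hpq (by simp; tauto)) z a (by simp at hz ⊢; tauto)
        (by simp; tauto)
    exact hn (h2.symm.trans h1)
  · refine h T A (by omega) ?_
    intro p q hp hq hpq
    by_cases he : s(p, q) = s(a, b)
    · rw [Sym2.eq_iff] at he
      rcases he with ⟨rfl, rfl⟩ | ⟨rfl, rfl⟩ <;> tauto
    · exact hA p q hp hq hpq he

/-- Deleting two edges. -/
theorem cut_two {V : Type u} [Fintype V] (G : SimpleGraph V) (hcard : 4 ≤ Nat.card V)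
    (h : CutGood G) (A : V → Prop) (a b c d : V) (hne : s(a, b) ≠ s(c, d))
    (hA : ∀ p q, G.Adj p q → s(p, q) ≠ s(a, b) → s(p, q) ≠ s(c, d) → (A p ↔ A q)) :
    ∀ x y, (A x ↔ A y) := by
  by_cases h1 : A a ↔ A b
  · intro x y
    refine cut_one G hcard h ∅ A c d (by simp) ?_ x y (by simp) (by simp)
    intro p q _ _ hpq hcd
    by_cases he : s(p, q) = s(a, b)
    · rw [Sym2.eq_iff] at he
      rcases he with ⟨rfl, rfl⟩ | ⟨rfl, rfl⟩ <;> tauto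
    · exact hA p q hpq he hcd
  by_cases h2 : A c ↔ A d
  · intro x y
    refine cut_one G hcard h ∅ A a b (by simp) ?_ x y (by simp) (by simp)
    intro p q _ _ hpq hab
    by_cases he : s(p, q) = s(c, d)
    · rw [Sym2.eq_iff] at he
      rcases he with ⟨rfl, rfl⟩ | ⟨rfl, rfl⟩ <;> tauto
    · exact hA p q hpq hab he
  exfalso
  have key : ∀ p q, (p = a ∨ p = b) → (q = c ∨ q = d) → ∀ x y, x ≠ p → x ≠ q → y ≠ p → y ≠ q →
      (A x ↔ A y) := by
    intro p q hp hq x y hxp hxq hyp hyq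
    refine h {p, q} A ?_ ?_ x y (by simp; tauto) (by simp; tauto)
    · have := Set.ncard_insert_le p {q}
      rw [Set.ncard_singleton] at this
      omega
    · intro r s hr hs hrs
      simp only [Set.mem_insert_iff, Set.mem_singleton_iff, not_or] at hr hs
      refine hA r s hrs ?_ ?_ <;> rw [Ne, Sym2.eq_iff] <;> grind
  have z3 : ∀ p q r : V, ∃ z, z ≠ p ∧ z ≠ q ∧ z ≠ r := by
    intro p q r
    obtain ⟨z, hz⟩ := exists_not_mem_of_ncard hcard {p, q, r} (by
      have h1 := Set.ncard_insert_le p {q, r}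
      have h2 := Set.ncard_insert_le q {r}
      rw [Set.ncard_singleton] at h2
      omega)
    exact ⟨z, by simpa using hz⟩
  have hab : a ≠ b := by rintro rfl; exact h1 Iff.rfl
  have hcd : c ≠ d := by rintro rfl; exact h2 Iff.rfl
  rw [Ne, Sym2.eq_iff] at hne
  have k1 := key a c (by simp) (by simp)
  have k2 := key a d (by simp) (by simp)
  have k3 := key b c (by simp) (by simp)
  have k4 := key b d (by simp) (by simp)
  clear key hA
  by_cases e0 : b = c
  · subst e0
    obtain ⟨z, hza, hzb, hzr⟩ := z3 a b d
    have m1 := k3 z a (by tauto) (by tauto) (by tauto) (by grind)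
    have m2 := k2 z b (by tauto) (by tauto) (by grind) (by grind)
    exact h1 (m1.symm.trans m2)
  by_cases e1 : b = d
  · subst e1
    obtain ⟨z, hza, hzb, hzr⟩ := z3 a b c
    have m1 := k4 z a (by tauto) (by tauto) (by tauto) (by grind)
    have m2 := k1 z b (by tauto) (by tauto) (by grind) (by grind)
    exact h1 (m1.symm.trans m2)
  by_cases e2 : a = c
  · subst e2
    obtain ⟨z, hza, hzb, hzr⟩ := z3 a b d
    have m1 := k4 z a (by tauto) (by tauto) (by tauto) (by grind)
    have m2 := k1 z b (by tauto) (by tauto) (by grind) (by grind)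
    exact h1 (m1.symm.trans m2)
  by_cases e3 : a = d
  · subst e3
    obtain ⟨z, hza, hzb, hzr⟩ := z3 a b c
    have m1 := k3 z a (by tauto) (by tauto) (by tauto) (by grind)
    have m2 := k2 z b (by tauto) (by tauto) (by grind) (by grind)
    exact h1 (m1.symm.trans m2)
  have m1 := k3 a d (by tauto) (by tauto) (by grind) (by grind)
  have m2 := k4 a c (by tauto) (by tauto) (by grind) (by grind)
  exact h2 (m2.symm.trans m1)

theorem ncard_pre_le {V W : Type u} [Fintype W] (f : V ↪ W) (S : Set W) :
    (f ⁻¹' S).ncard ≤ S.ncard := by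
  rw [← Set.ncard_image_of_injective _ f.injective]
  exact Set.ncard_le_ncard (Set.image_preimage_subset _ _) (Set.toFinite _)

theorem ncard_pre_lt {V W : Type u} [Fintype W] (f : V ↪ W) (S : Set W) (v : W)
    (hv : v ∈ S) (hf : ∀ x, f x ≠ v) : (f ⁻¹' S).ncard < S.ncard := by
  rw [← Set.ncard_image_of_injective _ f.injective]
  refine Set.ncard_lt_ncard ?_ (Set.toFinite _)
  refine ⟨Set.image_preimage_subset _ _, fun hs => ?_⟩
  obtain ⟨x, _, hx⟩ := hs hv
  exact hf x hx

theorem triple_not_subset {V : Type u} [Fintype V] (T : Set V) (hT : T.ncard < 3) (a b c : V)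
    (hab : a ≠ b) (hac : a ≠ c) (hbc : b ≠ c) : a ∉ T ∨ b ∉ T ∨ c ∉ T := by
  by_contra hcon
  push Not at hcon
  have hs : ({a, b, c} : Set V) ⊆ T := by
    rintro x (rfl | rfl | rfl)
    exacts [hcon.1, hcon.2.1, hcon.2.2]
  have h1 := Set.ncard_le_ncard hs (Set.toFinite _)
  have h2 : ({a, b, c} : Set V).ncard = 3 := Set.ncard_eq_three.2 ⟨a, b, c, hab, hac, hbc, rfl⟩
  omega

theorem vvAdd_cutGood {V W : Type u} [Fintype V] [Fintype W] (G : SimpleGraph V)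
    (G' : SimpleGraph W) (h : CutGood G) (hop : IsVVAdd G G') : CutGood G' := by
  obtain ⟨e, x, y, -, -, hadj⟩ := hop
  intro S A hS hA p q hp hq
  have hT := ncard_pre_le e.toEmbedding S
  have := h (e ⁻¹' S) (fun z => A (e z)) (lt_of_le_of_lt hT hS)
    (fun u v hu hv huv => hA _ _ hu hv ((hadj u v).2 (Or.inl huv))) (e.symm p) (e.symm q)
    (by simpa using hp) (by simpa using hq)
  simpa using this

theorem evAdd_cutGood {V W : Type u} [Fintype V] [Fintype W] (G : SimpleGraph V)
    (G' : SimpleGraph W) (hcard : 4 ≤ Nat.card V) (h : CutGood G) (hop : IsEVAdd G G') :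
    CutGood G' := by
  obtain ⟨f, v, a, b, w, hfv, hsurj, hab, hwa, hwb, hG', hv⟩ := hop
  intro S A hS hA
  have hT := ncard_pre_le f S
  by_cases hvS : v ∈ S
  · have hT' := ncard_pre_lt f S v hvS hfv
    have hc := cut_one G hcard h (f ⁻¹' S) (fun z => A (f z)) a b (by omega)
      (fun p q hp hq hpq hne => hA _ _ hp hq ((hG' p q).2 ⟨hpq, hne⟩))
    intro x y hx hy
    obtain rfl | ⟨x, rfl⟩ := hsurj x
    · exact absurd hvS hx
    obtain rfl | ⟨y, rfl⟩ := hsurj y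
    · exact absurd hvS hy
    exact hc x y hx hy
  · have hn : ∀ x, f x ∉ S → (x = a ∨ x = b ∨ x = w) → (A v ↔ A (f x)) :=
      fun x hx hx' => hA _ _ hvS hx ((hv x).2 hx')
    have hc := h (f ⁻¹' S) (fun z => A (f z)) (by omega) (by
      intro p q hp hq hpq
      by_cases he : s(p, q) = s(a, b)
      · have hpa : p = a ∨ p = b ∨ p = w := by rw [Sym2.eq_iff] at he; tauto
        have hqa : q = a ∨ q = b ∨ q = w := by rw [Sym2.eq_iff] at he; tauto
        exact (hn p hp hpa).symm.trans (hn q hq hqa)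
      · exact hA _ _ hp hq ((hG' p q).2 ⟨hpq, he⟩))
    have hall : ∀ x, f x ∉ S → (A v ↔ A (f x)) := by
      intro x hx
      rcases triple_not_subset (f ⁻¹' S) (by omega) a b w hab.ne hwa.symm hwb.symm with h0 | h0 | h0
      · exact (hn a h0 (by simp)).trans (hc a x h0 hx)
      · exact (hn b h0 (by simp)).trans (hc b x h0 hx)
      · exact (hn w h0 (by simp)).trans (hc w x h0 hx)
    have hall' : ∀ x, x ∉ S → (A v ↔ A x) := by
      intro x hx
      obtain rfl | ⟨x, rfl⟩ := hsurj x
      · exact Iff.rfl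
      · exact hall x hx
    exact fun x y hx hy => (hall' x hx).symm.trans (hall' y hy)

/-- The edge-edge case where the first new vertex is deleted and the second is not. -/
theorem eeAdd_aux {V W : Type u} [Fintype V] [Fintype W] (G : SimpleGraph V)
    (G' : SimpleGraph W) (hcard : 4 ≤ Nat.card V) (h : CutGood G) (f : V ↪ W) (v w : W)
    (a b c d : V) (hfv : ∀ x, f x ≠ v) (hsurj : ∀ z : W, z = v ∨ z = w ∨ ∃ x, f x = z)
    (hcd : G.Adj c d)
    (hG' : ∀ x y : V, G.Adj x y → s(x, y) ≠ s(a, b) → s(x, y) ≠ s(c, d) → G'.Adj (f x) (f y))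
    (hw : ∀ x : V, (x = c ∨ x = d) → G'.Adj w (f x))
    (S : Set W) (A : W → Prop) (hS : S.ncard < 3)
    (hA : ∀ p q, p ∉ S → q ∉ S → G'.Adj p q → (A p ↔ A q)) (hvS : v ∈ S) (hwS : w ∉ S) :
    ∀ x y, x ∉ S → y ∉ S → (A x ↔ A y) := by
  have hT' := ncard_pre_lt f S v hvS hfv
  have hn : ∀ x, f x ∉ S → (x = c ∨ x = d) → (A w ↔ A (f x)) :=
    fun x hx hx' => hA _ _ hwS hx (hw x hx')
  have hc := cut_one G hcard h (f ⁻¹' S) (fun z => A (f z)) a b (by omega) (by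
    intro p q hp hq hpq hne
    by_cases he : s(p, q) = s(c, d)
    · have hpa : p = c ∨ p = d := by rw [Sym2.eq_iff] at he; tauto
      have hqa : q = c ∨ q = d := by rw [Sym2.eq_iff] at he; tauto
      exact (hn p hp hpa).symm.trans (hn q hq hqa)
    · exact hA _ _ hp hq (hG' p q hpq hne he))
  have h0 : c ∉ f ⁻¹' S ∨ d ∉ f ⁻¹' S := by
    by_contra hcon
    push Not at hcon
    have hs : ({c, d} : Set V) ⊆ f ⁻¹' S := by
      rintro x (rfl | rfl)
      exacts [hcon.1, hcon.2]
    have h1 := Set.ncard_le_ncard hs (Set.toFinite _)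
    rw [Set.ncard_pair hcd.ne] at h1
    omega
  have hall : ∀ x, x ∉ S → (A w ↔ A x) := by
    intro x hx
    obtain rfl | rfl | ⟨x, rfl⟩ := hsurj x
    · exact absurd hvS hx
    · exact Iff.rfl
    · rcases h0 with h0 | h0
      · exact (hn c h0 (by simp)).trans (hc c x h0 hx)
      · exact (hn d h0 (by simp)).trans (hc d x h0 hx)
  exact fun x y hx hy => (hall x hx).symm.trans (hall y hy)

theorem eeAdd_cutGood {V W : Type u} [Fintype V] [Fintype W] (G : SimpleGraph V)
    (G' : SimpleGraph W) (hcard : 4 ≤ Nat.card V) (h : CutGood G) (hop : IsEEAdd G G') :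
    CutGood G' := by
  obtain ⟨f, v, w, a, b, c, d, hvw, hf, hsurj, hab, hcd, hne, hG', hv, hw, hadj⟩ := hop
  intro S A hS hA
  have hT := ncard_pre_le f S
  by_cases hvS : v ∈ S <;> by_cases hwS : w ∈ S
  · have hT0 : f ⁻¹' S = ∅ := by
      have hlt := ncard_pre_lt f (S \ {w}) v ⟨hvS, hvw⟩ (fun x => (hf x).1)
      have hd := Set.ncard_sdiff_singleton_add_one hwS (Set.toFinite _)
      have hz : (f ⁻¹' (S \ {w})).ncard = 0 ∨ (f ⁻¹' (S \ {w})).ncard = 0 := by omega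
      have hz' : f ⁻¹' (S \ {w}) = ∅ := by
        rw [← Set.ncard_eq_zero (Set.toFinite _)]
        omega
      ext x
      have hx : x ∉ f ⁻¹' (S \ {w}) := by rw [hz']; simp
      simp only [Set.mem_preimage, Set.mem_sdiff, Set.mem_singleton_iff, not_and, not_not] at hx
      simp only [Set.mem_preimage, Set.mem_empty_iff_false, iff_false]
      exact fun hxS => (hf x).2 (hx hxS)
    have hnot : ∀ x, f x ∉ S := fun x hx => by
      have : x ∈ f ⁻¹' S := hx
      rw [hT0] at this
      exact this
    have hc := cut_two G hcard h (fun z => A (f z)) a b c d hne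
      (fun p q hpq h1 h2 => hA _ _ (hnot p) (hnot q) ((hG' p q).2 ⟨hpq, h1, h2⟩))
    intro x y hx hy
    obtain rfl | rfl | ⟨x, rfl⟩ := hsurj x
    · exact absurd hvS hx
    · exact absurd hwS hx
    obtain rfl | rfl | ⟨y, rfl⟩ := hsurj y
    · exact absurd hvS hy
    · exact absurd hwS hy
    exact hc x y
  · exact eeAdd_aux G G' hcard h f v w a b c d (fun x => (hf x).1) hsurj hcd
      (fun x y h1 h2 h3 => (hG' x y).2 ⟨h1, h2, h3⟩) (fun x => (hw x).2) S A hS hA hvS hwS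
  · exact eeAdd_aux G G' hcard h f w v c d a b (fun x => (hf x).2)
      (fun z => by have := hsurj z; tauto) hab
      (fun x y h1 h2 h3 => (hG' x y).2 ⟨h1, h3, h2⟩) (fun x => (hv x).2) S A hS hA hwS hvS
  · have hvw' : A v ↔ A w := hA _ _ hvS hwS hadj
    have hn : ∀ x, f x ∉ S → (x = a ∨ x = b ∨ x = c ∨ x = d) → (A v ↔ A (f x)) := by
      intro x hx hx'
      by_cases h1 : x = a ∨ x = b
      · exact hA _ _ hvS hx ((hv x).2 h1)
      · exact hvw'.trans (hA _ _ hwS hx ((hw x).2 (by tauto)))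
    have hc := h (f ⁻¹' S) (fun z => A (f z)) (by omega) (by
      intro p q hp hq hpq
      by_cases he : s(p, q) = s(a, b) ∨ s(p, q) = s(c, d)
      · have hpa : p = a ∨ p = b ∨ p = c ∨ p = d := by
          rw [Sym2.eq_iff, Sym2.eq_iff] at he; tauto
        have hqa : q = a ∨ q = b ∨ q = c ∨ q = d := by
          rw [Sym2.eq_iff, Sym2.eq_iff] at he; tauto
        exact (hn p hp hpa).symm.trans (hn q hq hqa)
      · exact hA _ _ hp hq ((hG' p q).2 ⟨hpq, by tauto, by tauto⟩))
    have h0 : ∃ z, z ∉ f ⁻¹' S ∧ (z = a ∨ z = b ∨ z = c ∨ z = d) := by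
      rw [Ne, Sym2.eq_iff] at hne
      have hab' := hab.ne
      have hcd' := hcd.ne
      by_cases hc' : c = a ∨ c = b
      · rcases triple_not_subset (f ⁻¹' S) (by omega) a b d hab' (by grind) (by grind)
          with h0 | h0 | h0
        exacts [⟨a, h0, by simp⟩, ⟨b, h0, by simp⟩, ⟨d, h0, by simp⟩]
      · rcases triple_not_subset (f ⁻¹' S) (by omega) a b c hab' (by grind) (by grind)
          with h0 | h0 | h0
        exacts [⟨a, h0, by simp⟩, ⟨b, h0, by simp⟩, ⟨c, h0, by simp⟩]
    obtain ⟨z, hz, hz'⟩ := h0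
    have hall : ∀ x, x ∉ S → (A v ↔ A x) := by
      intro x hx
      obtain rfl | rfl | ⟨x, rfl⟩ := hsurj x
      · exact Iff.rfl
      · exact hvw'
      · exact (hn z hz hz').trans (hc z x hz hx)
    exact fun x y hx hy => (hall x hx).symm.trans (hall y hy)

/-- If `G` is a finite simple 3-connected graph and `G'` is obtained
from `G` by applying a single BG-operation, then `G'` is (simple, being a
`SimpleGraph`, and) 3-connected. -/
theorem bgOp_preserves_threeConnected {V W : Type u} [Fintype V] [Fintype W]
    (G : SimpleGraph V) (G' : SimpleGraph W) (hG : KConnected 3 G)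
    (hop : IsBGOp G G') : KConnected 3 G' := by
  have hcg := cutGood_of_kConnected G hG
  have hcard : 4 ≤ Nat.card V := hG.1
  rcases hop with hop | hop | hop
  · refine kConnected_of_cutGood G' ?_ (vvAdd_cutGood G G' hcg hop)
    obtain ⟨e, -⟩ := hop
    rwa [← Nat.card_congr e]
  · refine kConnected_of_cutGood G' ?_ (evAdd_cutGood G G' hcard hcg hop)
    obtain ⟨f, -⟩ := hop
    exact hcard.trans (Nat.card_le_card_of_injective f f.injective)
  · refine kConnected_of_cutGood G' ?_ (eeAdd_cutGood G G' hcard hcg hop)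
    obtain ⟨f, -⟩ := hop
    exact hcard.trans (Nat.card_le_card_of_injective f f.injective)
end
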